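/- Let D be an EAS division ring with |D| ≥ 4 and let m, n, m', n' ≥ 2 be integers. Suppose φ: D^{m×n} → D^{m'×n'} is a non-degenerate graph homomorphism with φ(0) = 0. Then either m' ≥ m, n' ≥ n, and there exist invertible matrices P ∈ GL_{m'}(D), Q ∈ GL_{n'}(D) and a ring automorphism τ of D such that φ(X) = P · diag(X^τ, 0) · Q for all X ∈ D^{m×n}; or m' ≥ n, n' ≥ m, and there exist invertible matrices P ∈ GL_{m'}(D), Q ∈ GL_{n'}(D) and a ring anti-automorphism σ of D such that φ(X) = P · diag(ᵗ(X^σ), 0) · Q for all X ∈ D^{m×n}. Here X^τ (resp. X^σ) means applying τ (resp. σ) entrywise and ᵗX denotes the transpose. -/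

import Mathlib

open Matrix

/-- Rank of a matrix over a division ring: dimension of the left row space. -/
noncomputable def mrank {D : Type} [DivisionRing D] {m n : ℕ} (A : Matrix (Fin m) (Fin n) D) : ℕ :=
  Module.finrank D (Submodule.span D (Set.range fun i : Fin m => fun j : Fin n => A i j))

/-- The standard maximal set of type one: matrices whose rows other than the first are zero. -/
def M1set (D : Type) [DivisionRing D] (m n : ℕ) : Set (Matrix (Fin m) (Fin n) D) :=
  {X | ∀ i j, i.val ≠ 0 → X i j = 0}

/-- The standard maximal set of type two: matrices whose columns other than the first are zero. -/
def N1set (D : Type) [DivisionRing D] (m n : ℕ) : Set (Matrix (Fin m) (Fin n) D) :=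
  {X | ∀ i j, j.val ≠ 0 → X i j = 0}

/-- A maximal set of type one: a set of the form `P·M₁ + A` with `P` invertible. -/
def IsTypeOne {D : Type} [DivisionRing D] {m n : ℕ} (S : Set (Matrix (Fin m) (Fin n) D)) : Prop :=
  ∃ P : Matrix (Fin m) (Fin m) D, ∃ A : Matrix (Fin m) (Fin n) D,
    IsUnit P ∧ S = (fun X => P * X + A) '' M1set D m n

/-- A maximal set of type two: a set of the form `N₁·Q + A` with `Q` invertible. -/
def IsTypeTwo {D : Type} [DivisionRing D] {m n : ℕ} (S : Set (Matrix (Fin m) (Fin n) D)) : Prop :=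
  ∃ Q : Matrix (Fin n) (Fin n) D, ∃ A : Matrix (Fin m) (Fin n) D,
    IsUnit Q ∧ S = (fun X => X * Q + A) '' N1set D m n

/-- A maximal set (maximal clique of the adjacency graph): of type one or type two. -/
def IsMaximalSet {D : Type} [DivisionRing D] {m n : ℕ}
    (S : Set (Matrix (Fin m) (Fin n) D)) : Prop :=
  IsTypeOne S ∨ IsTypeTwo S

/-- A graph homomorphism `φ` is degenerate if there is a matrix `A` of rank at most one and two
maximal sets of different types `Ms`, `Ns` in the target with `φ A ∈ Ms ∩ Ns` and the image of
the unit ball around `A` contained in `Ms ∪ Ns`. -/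
def Degenerate {D D' : Type} [DivisionRing D] [DivisionRing D'] {m n m' n' : ℕ}
    (φ : Matrix (Fin m) (Fin n) D → Matrix (Fin m') (Fin n') D') : Prop :=
  ∃ A : Matrix (Fin m) (Fin n) D, mrank A ≤ 1 ∧
    ∃ Ms Ns : Set (Matrix (Fin m') (Fin n') D'),
      IsTypeOne Ms ∧ IsTypeTwo Ns ∧ φ A ∈ Ms ∩ Ns ∧
      φ '' {X | mrank (X - A) ≤ 1} ⊆ Ms ∪ Ns

/-- Embed a matrix `Y` as the upper-left block `diag(Y, 0)` of a (possibly) larger matrix. -/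
def embedM {R : Type} [Zero R] {a b a' b' : ℕ} (Y : Matrix (Fin a) (Fin b) R) :
    Matrix (Fin a') (Fin b') R :=
  Matrix.of fun i j => if h : i.val < a ∧ j.val < b then Y ⟨i.val, h.1⟩ ⟨j.val, h.2⟩ else 0

section PlaneLineation

variable {D E W : Type*} [DivisionRing D] [DivisionRing E] [AddCommGroup W] [Module E W]

open Submodule in
/-- A map from the affine plane over `D` to the projective geometry of an `E`-space `W`, given by
representing vectors, which maps lines into lines, is injective, and has a non-collinear image. -/
structure IsPlaneLineation (E : Type*) [DivisionRing E] [Module E W] (F : D × D → W) : Prop where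
  line : ∀ (p v : D × D) (t : D), v ≠ 0 → F (p + t • v) ∈ span E {F p, F (p + v)}
  pair : ∀ p q, p ≠ q → LinearIndependent E ![F p, F q]
  noncollinear : ∀ p q, ∃ r, F r ∉ span E {F p, F q}

open Submodule

theorem span_pair_eq_of_mem {a b c d : W} (hcd : LinearIndependent E ![c, d])
    (hc : c ∈ span E {a, b}) (hd : d ∈ span E {a, b}) : span E {a, b} = span E {c, d} := by
  classical
  have hle : span E {c, d} ≤ span E {a, b} := by
    rw [span_le]
    rintro x (rfl | rfl)
    · exact hc
    · exact hd
  have h2 : Module.finrank E (span E {c, d}) = 2 := by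
    have := finrank_span_eq_card hcd
    rwa [Matrix.range_cons_cons_empty, Fintype.card_fin] at this
  have h1 : Module.finrank E (span E {a, b}) ≤ 2 := by
    have := finrank_span_finset_le_card (R := E) ({a, b} : Finset W)
    simp only [Finset.coe_insert, Finset.coe_singleton] at this
    exact this.trans Finset.card_le_two
  have : Module.Finite E (span E {a, b}) := Module.Finite.span_of_finite E (by simp)
  exact (eq_of_le_of_finrank_le hle (by omega)).symm

theorem indep_triple_of_notMem {a b c : W} (hab : LinearIndependent E ![a, b])
    (hc : c ∉ span E {a, b}) (x y z : E) (h : x • a + y • b + z • c = 0) :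
    x = 0 ∧ y = 0 ∧ z = 0 := by
  have hz : z = 0 := by
    by_contra hz
    apply hc
    have : c = (-z⁻¹ * x) • a + (-z⁻¹ * y) • b := by
      have h3 : z • c = -(x • a + y • b) := by rw [eq_neg_iff_add_eq_zero, add_comm]; exact h
      have h4 : c = z⁻¹ • (z • c) := by rw [smul_smul, inv_mul_cancel₀ hz, one_smul]
      rw [h4, h3]
      simp only [smul_neg, smul_add, neg_mul, neg_smul, smul_smul, neg_add]
    rw [this]
    exact mem_span_pair.2 ⟨_, _, rfl⟩
  subst hz
  rw [zero_smul, add_zero] at h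
  obtain ⟨h1, h2⟩ := LinearIndependent.pair_iff.1 hab x y h
  exact ⟨h1, h2, rfl⟩

/-- Two triangles in perspective from a line are in perspective from a point. -/
theorem exists_center_of_axis {a₁ a₂ a₃ b₁ b₂ b₃ c₁₂ c₂₃ c₃₁ : W}
    (ha : ∀ x y z : E, x • a₁ + y • a₂ + z • a₃ = 0 → x = 0 ∧ y = 0 ∧ z = 0)
    (hb : ∀ x y z : E, x • b₁ + y • b₂ + z • b₃ = 0 → x = 0 ∧ y = 0 ∧ z = 0)
    (h₁ : LinearIndependent E ![a₁, b₁])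
    (ha₁₂ : c₁₂ ∈ span E {a₁, a₂}) (ha₂₃ : c₂₃ ∈ span E {a₂, a₃}) (ha₃₁ : c₃₁ ∈ span E {a₃, a₁})
    (hb₁₂ : c₁₂ ∈ span E {b₁, b₂}) (hb₂₃ : c₂₃ ∈ span E {b₂, b₃}) (hb₃₁ : c₃₁ ∈ span E {b₃, b₁})
    (hc : c₃₁ ∈ span E {c₁₂, c₂₃}) (hne : ∀ r : E, c₃₁ ≠ r • a₃) :
    ∃ o : W, o ≠ 0 ∧ o ∈ span E {a₁, b₁} ∧ o ∈ span E {a₂, b₂} ∧ o ∈ span E {a₃, b₃} := by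
  rw [mem_span_pair] at *
  obtain ⟨p₁, p₂, hp⟩ := ha₁₂
  obtain ⟨q₂, q₃, hq⟩ := ha₂₃
  obtain ⟨r₃, r₁, hr⟩ := ha₃₁
  obtain ⟨p₁', p₂', hp'⟩ := hb₁₂
  obtain ⟨q₂', q₃', hq'⟩ := hb₂₃
  obtain ⟨r₃', r₁', hr'⟩ := hb₃₁
  obtain ⟨k, l, hkl⟩ := hc
  have e := ha (k * p₁ - r₁) (k * p₂ + l * q₂) (l * q₃ - r₃) (by
    have : k • (p₁ • a₁ + p₂ • a₂) + l • (q₂ • a₂ + q₃ • a₃) - (r₃ • a₃ + r₁ • a₁) = 0 := by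
      rw [hp, hq, hr, hkl, sub_self]
    rw [← this]
    simp only [smul_add, smul_smul, add_smul, sub_smul]
    abel)
  have e' := hb (k * p₁' - r₁') (k * p₂' + l * q₂') (l * q₃' - r₃') (by
    have : k • (p₁' • b₁ + p₂' • b₂) + l • (q₂' • b₂ + q₃' • b₃) - (r₃' • b₃ + r₁' • b₁) = 0 := by
      rw [hp', hq', hr', hkl, sub_self]
    rw [← this]
    simp only [smul_add, smul_smul, add_smul, sub_smul]
    abel)
  obtain ⟨e1, e2, e3⟩ := e
  obtain ⟨e1', e2', e3'⟩ := e'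
  rw [sub_eq_zero] at e1 e3 e1' e3'
  have hr1 : r₁ ≠ 0 := by
    rintro rfl
    apply hne r₃
    rw [← hr, zero_smul, add_zero]
  have hk : r₁ • a₁ + (k * p₂) • a₂ = r₁' • b₁ + (k * p₂') • b₂ := by
    have : k • (p₁ • a₁ + p₂ • a₂) = k • (p₁' • b₁ + p₂' • b₂) := by rw [hp, hp']
    simpa only [smul_add, smul_smul, e1, e1'] using this
  have hl : (l * q₂) • a₂ + r₃ • a₃ = (l * q₂') • b₂ + r₃' • b₃ := by
    have : l • (q₂ • a₂ + q₃ • a₃) = l • (q₂' • b₂ + q₃' • b₃) := by rw [hq, hq']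
    simpa only [smul_add, smul_smul, e3, e3'] using this
  have f2 : l * q₂ = -(k * p₂) := by rw [eq_neg_iff_add_eq_zero, add_comm]; exact e2
  have f2' : l * q₂' = -(k * p₂') := by rw [eq_neg_iff_add_eq_zero, add_comm]; exact e2'
  rw [f2, f2', neg_smul, neg_smul] at hl
  refine ⟨r₁ • a₁ - r₁' • b₁, ?_, ?_, ?_, ?_⟩
  · intro h
    apply hr1
    refine (LinearIndependent.pair_iff.1 h₁ r₁ (-r₁') ?_).1
    rw [neg_smul, ← sub_eq_add_neg, h]
  · exact mem_span_pair.2 ⟨r₁, -r₁', by rw [neg_smul, sub_eq_add_neg]⟩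
  · refine mem_span_pair.2 ⟨-(k * p₂), k * p₂', ?_⟩
    rw [neg_smul, neg_add_eq_sub, sub_eq_sub_iff_add_eq_add, add_comm _ (r₁' • b₁), ← hk]
  · refine mem_span_pair.2 ⟨-r₃, r₃', ?_⟩
    have h1 : r₁ • a₁ - r₁' • b₁ = (k * p₂') • b₂ - (k * p₂) • a₂ := by
      rw [sub_eq_sub_iff_add_eq_add, hk, add_comm]
    rw [h1, neg_smul, neg_add_eq_sub, sub_eq_sub_iff_add_eq_add]
    have h2 := congrArg (fun z => z + (k * p₂) • a₂ + (k * p₂') • b₂) hl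
    calc _ = -((k * p₂') • b₂) + r₃' • b₃ + (k * p₂) • a₂ + (k * p₂') • b₂ := by abel
      _ = _ := by rw [← h2]; abel

namespace IsPlaneLineation

variable {F : D × D → W}

theorem notMem_span (hF : IsPlaneLineation E F) (hD : ∀ s : D, ∃ c, c ≠ 0 ∧ c ≠ s)
    {p v w : D × D} (h : LinearIndependent D ![v, w]) :
    F (p + w) ∉ span E {F p, F (p + v)} := by
  intro hw
  have hv0 : v ≠ 0 := h.ne_zero 0
  have hw0 : w ≠ 0 := h.ne_zero 1
  have h1 : ∀ s : D, F (p + s • v) ∈ span E {F p, F (p + v)} := fun s => hF.line p v s hv0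
  have h2 : ∀ t : D, F (p + t • w) ∈ span E {F p, F (p + v)} := by
    intro t
    refine (span_le.2 ?_ : span E {F p, F (p + w)} ≤ _) (hF.line p w t hw0)
    rintro x (rfl | rfl)
    · exact subset_span (by simp)
    · exact hw
  have h3 : ∀ s t : D, F (p + s • v + t • w) ∈ span E {F p, F (p + v)} := by
    intro s t
    by_cases ht : t = 0
    · subst ht; simpa using h1 s
    obtain ⟨c, hc0, hcs⟩ := hD s
    have hsc : s - c ≠ 0 := sub_ne_zero.2 (Ne.symm hcs)
    set u := (s - c) • v + t • w with hu
    have hu0 : u ≠ 0 := fun h0 => ht (LinearIndependent.pair_iff.1 h _ _ h0).2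
    set l : D := -(c * (s - c)⁻¹) with hl
    have hl0 : l ≠ 0 := by rw [hl, neg_ne_zero]; exact mul_ne_zero hc0 (inv_ne_zero hsc)
    have hP2 : p + c • v + l • u = p + (l * t) • w := by
      have : l * (s - c) = -c := by rw [hl, neg_mul, mul_assoc, inv_mul_cancel₀ hsc, mul_one]
      rw [hu, smul_add, smul_smul, smul_smul, this, neg_smul]; abel
    have hX : p + s • v + t • w = p + c • v + l⁻¹ • (l • u) := by
      rw [smul_smul, inv_mul_cancel₀ hl0, one_smul, hu, sub_smul]; abel
    rw [hX]
    refine (span_le.2 ?_ : span E {F (p + c • v), F (p + c • v + l • u)} ≤ _)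
      (hF.line _ (l • u) l⁻¹ (smul_ne_zero hl0 hu0))
    rintro x (rfl | rfl)
    · exact h1 c
    · rw [hP2]; exact h2 _
  obtain ⟨r, hr⟩ := hF.noncollinear p (p + v)
  apply hr
  have htop : span D (Set.range ![v, w]) = ⊤ := h.span_eq_top_of_card_eq_finrank (by simp)
  have hmem : r - p ∈ span D {v, w} := by
    have : (Set.range ![v, w]) = {v, w} := Matrix.range_cons_cons_empty _ _ _
    rw [← this, htop]; trivial
  obtain ⟨s, t, hst⟩ := mem_span_pair.1 hmem
  have := h3 s t
  rwa [add_assoc, hst, add_sub_cancel] at this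

theorem mem_span_of_ne (hF : IsPlaneLineation E F) {p v : D × D} {s s' : D} (hv : v ≠ 0)
    (hs : s ≠ s') (t : D) : F (p + t • v) ∈ span E {F (p + s • v), F (p + s' • v)} := by
  have hs' : s' - s ≠ 0 := sub_ne_zero.2 (Ne.symm hs)
  have := hF.line (p + s • v) ((s' - s) • v) ((t - s) * (s' - s)⁻¹) (smul_ne_zero hs' hv)
  have e1 : p + s • v + ((t - s) * (s' - s)⁻¹) • (s' - s) • v = p + t • v := by
    rw [smul_smul, mul_assoc, inv_mul_cancel₀ hs', mul_one, sub_smul]; abel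
  have e2 : p + s • v + (s' - s) • v = p + s' • v := by rw [sub_smul]; abel
  rwa [e1, e2] at this

theorem span_eq_of_ne (hF : IsPlaneLineation E F) {p v : D × D} {s s' t t' : D} (hv : v ≠ 0)
    (hs : s ≠ s') (ht : t ≠ t') : span E {F (p + s • v), F (p + s' • v)} =
      span E {F (p + t • v), F (p + t' • v)} := by
  refine span_pair_eq_of_mem (hF.pair _ _ ?_) (hF.mem_span_of_ne hv hs t)
    (hF.mem_span_of_ne hv hs t')
  intro h
  exact ht (smul_left_injective D hv (add_left_cancel h))

end IsPlaneLineation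

end PlaneLineation

section Concurrency

open Submodule

theorem exists_triple_of_card {D : Type*} [DivisionRing D]
    (hD : ∃ g h : D, g ≠ 0 ∧ g ≠ 1 ∧ h ≠ 0 ∧ h ≠ 1 ∧ g ≠ h) (b : D) :
    ∃ a₁ a₂ a₃ : D, a₁ ≠ 0 ∧ a₂ ≠ 0 ∧ a₃ ≠ 0 ∧ a₁ ≠ a₂ ∧ a₂ ≠ a₃ ∧ a₃ ≠ a₁ ∧
      a₃ - a₁ ≠ b * (a₂ - a₁) := by
  have key : ∃ u₁ u₂ u₃ : D, u₁ ≠ 0 ∧ u₂ ≠ 0 ∧ u₃ ≠ 0 ∧ u₁ ≠ u₂ ∧ u₂ ≠ u₃ ∧ u₃ ≠ u₁ ∧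
      u₁ + u₂ ≠ u₃ + u₃ := by
    obtain ⟨g, h, hg0, hg1, hh0, hh1, hgh⟩ := hD
    by_cases c1 : 1 + g = h + h
    · by_cases c2 : 1 + h = g + g
      · have h3 : (g - h) + (g - h) + (g - h) = 0 := by
          have : g - h = (h + h) - (g + g) := by rw [← c1, ← c2]; abel
          have h4 : (g - h) + ((g + g) - (h + h)) = 0 := by rw [this]; abel
          rw [← h4]; abel
        have h31 : (1 : D) + 1 + 1 = 0 := by
          have : (1 + 1 + 1) * (g - h) = 0 := by rw [← h3]; noncomm_ring
          exact (mul_eq_zero.1 this).resolve_right (sub_ne_zero.2 hgh)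
        have h2 : (-1 : D) ≠ 1 := by
          intro h'
          have : (1 : D) + 1 = 0 := by nth_rewrite 1 [← h']; simp
          rw [this] at h31; simp at h31
        have h5 : ∀ e : D, e ≠ 0 → e ≠ 1 → e ≠ -1 → ∃ u₁ u₂ u₃ : D, u₁ ≠ 0 ∧ u₂ ≠ 0 ∧ u₃ ≠ 0 ∧
            u₁ ≠ u₂ ∧ u₂ ≠ u₃ ∧ u₃ ≠ u₁ ∧ u₁ + u₂ ≠ u₃ + u₃ := by
          intro e e0 e1 e2
          refine ⟨1, -1, e, one_ne_zero, by simp, e0, h2.symm, e2.symm, e1, ?_⟩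
          intro h'
          have : (1 + 1) * e = 0 := by rw [add_mul, one_mul, ← h']; simp
          rcases mul_eq_zero.1 this with h'' | h''
          · rw [h''] at h31; simp at h31
          · exact e0 h''
        by_cases c3 : g = -1
        · exact h5 h hh0 hh1 (fun h' => hgh (c3.trans h'.symm))
        · exact h5 g hg0 hg1 c3
      · exact ⟨1, h, g, one_ne_zero, hh0, hg0, hh1.symm, hgh.symm, hg1, c2⟩
    · exact ⟨1, g, h, one_ne_zero, hg0, hh0, hg1.symm, hgh, hh1, c1⟩
  obtain ⟨u₁, u₂, u₃, h1, h2, h3, h12, h23, h31, hs⟩ := key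
  by_cases c : u₃ - u₁ = b * (u₂ - u₁)
  · refine ⟨u₂, u₁, u₃, h2, h1, h3, h12.symm, h31.symm, h23.symm, ?_⟩
    intro c'
    apply hs
    have : (u₃ - u₁) + (u₃ - u₂) = 0 := by rw [c, c']; noncomm_ring
    rw [← sub_eq_zero, ← neg_eq_zero, ← this]; abel
  · exact ⟨u₁, u₂, u₃, h1, h2, h3, h12, h23, h31, c⟩

variable {D E W : Type*} [DivisionRing D] [DivisionRing E] [AddCommGroup W] [Module E W]

namespace IsPlaneLineation

variable {F : D × D → W}

theorem mem_span_axis (hF : IsPlaneLineation E F) {a a' s : D} (c c' : D) (h : a ≠ a')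
    (hs : s ≠ 0) :
    F (0, c + -(a * (a' - a)⁻¹) * (c' - c)) ∈ span E {F (a * s, c), F (a' * s, c')} := by
  have ha : a' - a ≠ 0 := sub_ne_zero.2 h.symm
  have := hF.line (a * s, c) ((a' - a) * s, c' - c) (-(a * (a' - a)⁻¹))
    (fun h0 => mul_ne_zero ha hs (Prod.ext_iff.1 h0).1)
  have e1 : (a * s, c) + -(a * (a' - a)⁻¹) • ((a' - a) * s, c' - c) =
      (0, c + -(a * (a' - a)⁻¹) * (c' - c)) := by
    refine Prod.ext ?_ ?_
    · simp only [Prod.fst_add, Prod.smul_fst, smul_eq_mul]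
      rw [← mul_assoc, neg_mul, mul_assoc a, inv_mul_cancel₀ ha]; simp
    · simp
  have e2 : (a * s, c) + ((a' - a) * s, c' - c) = (a' * s, c') := by
    refine Prod.ext ?_ ?_ <;> simp [sub_mul]
  rwa [e1, e2] at this

theorem indep_of_slope (hF : IsPlaneLineation E F) (hD : ∀ s : D, ∃ c, c ≠ 0 ∧ c ≠ s)
    {a₁ a₂ a₃ b : D} (h : a₃ - a₁ ≠ b * (a₂ - a₁)) (x y z : E)
    (h0 : x • F (a₁, 0) + y • F (a₂, 1) + z • F (a₃, b) = 0) : x = 0 ∧ y = 0 ∧ z = 0 := by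
  refine indep_triple_of_notMem (hF.pair _ _ ?_) ?_ x y z h0
  · simp
  · have hind : LinearIndependent D ![((a₂ - a₁, 1) : D × D), (a₃ - a₁, b)] := by
      rw [LinearIndependent.pair_iff]
      intro s t hst
      rw [Prod.ext_iff] at hst
      simp only [Prod.fst_add, Prod.smul_fst, Prod.snd_add, Prod.smul_snd, smul_eq_mul, mul_one,
        Prod.fst_zero, Prod.snd_zero] at hst
      obtain ⟨e1, e2⟩ := hst
      have hs : s = -(t * b) := by rw [eq_neg_iff_add_eq_zero]; exact e2
      have ht : t * ((a₃ - a₁) - b * (a₂ - a₁)) = 0 := by rw [← e1, hs]; noncomm_ring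
      have ht0 : t = 0 := (mul_eq_zero.1 ht).resolve_right (sub_ne_zero.2 h)
      exact ⟨by rw [hs, ht0]; simp, ht0⟩
    have := hF.notMem_span hD (p := (a₁, 0)) hind
    simpa using this

theorem exists_common_three (hF : IsPlaneLineation E F)
    (hD : ∃ g h : D, g ≠ 0 ∧ g ≠ 1 ∧ h ≠ 0 ∧ h ≠ 1 ∧ g ≠ h) (b : D) :
    ∃ o : W, o ≠ 0 ∧ (∀ a a', a ≠ a' → o ∈ span E {F (a, 0), F (a', 0)}) ∧
      (∀ a a', a ≠ a' → o ∈ span E {F (a, 1), F (a', 1)}) ∧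
      (∀ a a', a ≠ a' → o ∈ span E {F (a, b), F (a', b)}) := by
  have hD3 : ∀ s : D, ∃ c, c ≠ 0 ∧ c ≠ s := by
    obtain ⟨g, h, hg0, hg1, -⟩ := hD
    intro s
    by_cases hs : g = s
    · exact ⟨1, one_ne_zero, fun h' => hg1 (hs.trans h'.symm)⟩
    · exact ⟨g, hg0, hs⟩
  obtain ⟨a₁, a₂, a₃, h1, h2, h3, h12, h23, h31, hs⟩ := exists_triple_of_card hD b
  obtain ⟨s, hs0, hs1⟩ := hD3 1
  have hne : ∀ a : D, a ≠ 0 → a ≠ a * s := fun a ha h => hs1 (by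
    have : a * (s - 1) = 0 := by rw [mul_sub, mul_one, ← h, sub_self]
    exact sub_eq_zero.1 ((mul_eq_zero.1 this).resolve_left ha))
  have hslope : a₃ * s - a₁ * s ≠ b * (a₂ * s - a₁ * s) := by
    rw [← sub_mul, ← sub_mul, ← mul_assoc]
    exact fun h => hs (mul_right_cancel₀ hs0 h)
  have iA := hF.indep_of_slope hD3 hs
  have iB := hF.indep_of_slope hD3 hslope
  have m12 := hF.mem_span_axis 0 1 h12 one_ne_zero
  have m23 := hF.mem_span_axis 1 b h23 one_ne_zero
  have m31 := hF.mem_span_axis b 0 h31 one_ne_zero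
  simp only [mul_one] at m12 m23 m31
  have n12 := hF.mem_span_axis 0 1 h12 hs0
  have n23 := hF.mem_span_axis 1 b h23 hs0
  have n31 := hF.mem_span_axis b 0 h31 hs0
  set y₁ := 0 + -(a₁ * (a₂ - a₁)⁻¹) * (1 - 0) with hy1
  set y₂ := 1 + -(a₂ * (a₃ - a₂)⁻¹) * (b - 1) with hy2
  set y₃ := b + -(a₃ * (a₁ - a₃)⁻¹) * (0 - b) with hy3
  have hy : y₁ ≠ y₂ := by
    intro hy
    rw [hy] at m12
    obtain ⟨p, q, hpq⟩ := mem_span_pair.1 m12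
    obtain ⟨p', q', hpq'⟩ := mem_span_pair.1 m23
    have := iA p (q - p') (-q') (by
      rw [sub_smul, neg_smul]
      have : (p • F (a₁, 0) + q • F (a₂, 1)) - (p' • F (a₂, 1) + q' • F (a₃, b)) = 0 := by
        rw [hpq, hpq', sub_self]
      rw [← this]; abel)
    rw [this.1, zero_smul, zero_add] at hpq
    have := LinearIndependent.pair_iff.1 (hF.pair (0, y₂) (a₂, 1) (fun h' => h2
      (Prod.ext_iff.1 h').1.symm)) 1 (-q) (by rw [neg_smul, hpq, one_smul, add_neg_cancel])
    exact one_ne_zero this.1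
  have hc : F (0, y₃) ∈ span E {F (0, y₁), F (0, y₂)} := by
    have := hF.mem_span_of_ne (p := (0, 0)) (v := (0, 1)) (by simp) hy y₃
    simpa using this
  obtain ⟨o, ho0, ho1, ho2, ho3⟩ := exists_center_of_axis iA iB
    (hF.pair _ _ (fun h' => hne a₁ h1 (Prod.ext_iff.1 h').1)) m12 m23 m31 n12 n23 n31 hc (by
      intro r hr
      have := LinearIndependent.pair_iff.1 (hF.pair (0, y₃) (a₃, b) (fun h' => h3
        (Prod.ext_iff.1 h').1.symm)) 1 (-r) (by rw [neg_smul, hr, one_smul, add_neg_cancel])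
      exact one_ne_zero this.1)
  have hconv : ∀ c x x' a a' : D, x ≠ x' → a ≠ a' →
      span E {F (x, c), F (x', c)} = span E {F (a, c), F (a', c)} := by
    intro c x x' a a' hx ha
    have := hF.span_eq_of_ne (p := (0, c)) (v := (1, 0)) (by simp) hx ha
    simpa using this
  refine ⟨o, ho0, fun a a' ha => ?_, fun a a' ha => ?_, fun a a' ha => ?_⟩
  · rwa [← hconv 0 _ _ a a' (hne a₁ h1) ha]
  · rwa [← hconv 1 _ _ a a' (hne a₂ h2) ha]
  · rwa [← hconv b _ _ a a' (hne a₃ h3) ha]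

theorem notMem_span_horizontal (hF : IsPlaneLineation E F) (hD : ∀ s : D, ∃ c, c ≠ 0 ∧ c ≠ s)
    {a a' x b c : D} (ha : a ≠ a') (hb : b ≠ c) : F (x, c) ∉ span E {F (a, b), F (a', b)} := by
  have hind : LinearIndependent D ![((a' - a, 0) : D × D), (x - a, c - b)] := by
    rw [LinearIndependent.pair_iff]
    intro s t hst
    rw [Prod.ext_iff] at hst
    simp only [Prod.fst_add, Prod.smul_fst, Prod.snd_add, Prod.smul_snd, smul_eq_mul, mul_zero,
      zero_add, Prod.fst_zero, Prod.snd_zero] at hst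
    obtain ⟨e1, e2⟩ := hst
    have ht : t = 0 := (mul_eq_zero.1 e2).resolve_right (sub_ne_zero.2 hb.symm)
    subst ht
    rw [zero_mul, add_zero] at e1
    exact ⟨(mul_eq_zero.1 e1).resolve_right (sub_ne_zero.2 ha.symm), rfl⟩
  have := hF.notMem_span hD (p := (a, b)) hind
  simpa using this

/-- The images of the horizontal lines are concurrent. -/
theorem exists_common (hF : IsPlaneLineation E F)
    (hD : ∃ g h : D, g ≠ 0 ∧ g ≠ 1 ∧ h ≠ 0 ∧ h ≠ 1 ∧ g ≠ h) :
    ∃ o : W, o ≠ 0 ∧ ∀ a a' b, a ≠ a' → o ∈ span E {F (a, b), F (a', b)} := by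
  have hD3 : ∀ s : D, ∃ c, c ≠ 0 ∧ c ≠ s := by
    obtain ⟨g, h, hg0, hg1, -⟩ := hD
    intro s
    by_cases hs : g = s
    · exact ⟨1, one_ne_zero, fun h' => hg1 (hs.trans h'.symm)⟩
    · exact ⟨g, hg0, hs⟩
  obtain ⟨o, ho, o0, o1, -⟩ := hF.exists_common_three hD 0
  refine ⟨o, ho, fun a a' b ha => ?_⟩
  obtain ⟨o', ho', o0', o1', ob'⟩ := hF.exists_common_three hD b
  by_cases hi : LinearIndependent E ![o', o]
  · exfalso
    have e0 := span_pair_eq_of_mem hi (o0' 0 1 zero_ne_one) (o0 0 1 zero_ne_one)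
    have e1 := span_pair_eq_of_mem hi (o1' 0 1 zero_ne_one) (o1 0 1 zero_ne_one)
    have := hF.notMem_span_horizontal hD3 (x := 0) (zero_ne_one (α := D)) (zero_ne_one (α := D))
    apply this
    rw [e0, ← e1]
    exact subset_span (by simp)
  · rw [LinearIndependent.pair_iff' ho'] at hi
    push Not at hi
    obtain ⟨r, rfl⟩ := hi
    exact smul_mem _ _ (ob' a a' ha)

end IsPlaneLineation

end Concurrency

section AffineForm

open Submodule

theorem exists_ringHom_of_coordinates {D E : Type*} [DivisionRing D] [DivisionRing E]
    (hD : ∃ t : D, t ≠ 0 ∧ t ≠ 1) {σ₁ σ₂ : D → E} (z₁ : σ₁ 0 = 0) (i₁ : Function.Injective σ₁)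
    (z₂ : σ₂ 0 = 0) (i₂ : Function.Injective σ₂)
    (hline : ∀ v₁ v₂ t : D, v₁ ≠ 0 → ∃ k : E, σ₁ (t * v₁) = k * σ₁ v₁ ∧ σ₂ (t * v₂) = k * σ₂ v₂)
    {d₀ d₁ d₂ : E} (hd : ¬ (d₀ = 0 ∧ d₁ = 0 ∧ d₂ = 0))
    (hdiag : ∀ c a a' : D, a ≠ a' → ∃ k l : E, d₀ = k + l ∧
      d₁ = k * σ₁ (a + c) + l * σ₁ (a' + c) ∧ d₂ = k * σ₂ a + l * σ₂ a') :
    ∃ ρ : D →+* E, (∀ a, σ₁ a = ρ a * σ₁ 1) ∧ ∀ a, σ₂ a = ρ a * σ₂ 1 := by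
  have n₁ : σ₁ 1 ≠ 0 := fun h => one_ne_zero (i₁ (h.trans z₁.symm))
  have n₂ : σ₂ 1 ≠ 0 := fun h => one_ne_zero (i₂ (h.trans z₂.symm))
  obtain ⟨ρ, hρ⟩ : ∃ ρ : D → E, ∀ a, ρ a = σ₁ a * (σ₁ 1)⁻¹ := ⟨_, fun _ => rfl⟩
  have h₁ : ∀ a, σ₁ a = ρ a * σ₁ 1 := fun a => by
    rw [hρ, mul_assoc, inv_mul_cancel₀ n₁, mul_one]
  have h₂' : ∀ t b, σ₂ (t * b) = ρ t * σ₂ b := by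
    intro t b
    obtain ⟨k, hk1, hk2⟩ := hline 1 b t one_ne_zero
    rw [mul_one, h₁] at hk1
    rw [hk2, mul_right_cancel₀ n₁ hk1]
  have h₂ : ∀ a, σ₂ a = ρ a * σ₂ 1 := fun a => by rw [← h₂', mul_one]
  have hmul : ∀ a b, ρ (a * b) = ρ a * ρ b := by
    intro a b
    have := h₂' a b
    rw [h₂ (a * b), h₂ b, ← mul_assoc] at this
    exact mul_right_cancel₀ n₂ this
  have hone : ρ 1 = 1 := by rw [hρ, mul_inv_cancel₀ n₁]
  have hzero : ρ 0 = 0 := by rw [hρ, z₁, zero_mul]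
  have hinj : Function.Injective ρ := by
    intro a b hab
    exact i₁ (by rw [h₁, h₁ b, hab])
  have hne : ∀ a, a ≠ 0 → ρ a ≠ 0 := fun a ha h => ha (hinj (h.trans hzero.symm))
  obtain ⟨e, he1, he2⟩ : ∃ e, d₁ = e * σ₁ 1 ∧ d₂ = e * σ₂ 1 := by
    obtain ⟨k, l, -, h1, h2⟩ := hdiag 0 1 0 one_ne_zero
    exact ⟨k, by simpa [z₁] using h1, by simpa [z₂] using h2⟩
  have hdiag' : ∀ c a, a ≠ 0 → ∃ k l : E, d₀ = k + l ∧ e = k * ρ (a + c) + l * ρ c ∧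
      e = k * ρ a := by
    intro c a ha
    obtain ⟨k, l, h0, h1, h2⟩ := hdiag c a 0 ha
    refine ⟨k, l, h0, ?_, ?_⟩
    · rw [he1, h₁ (a + c), h₁ (0 + c), ← mul_assoc, ← mul_assoc, ← add_mul, zero_add] at h1
      exact mul_right_cancel₀ n₁ h1
    · rw [he2, z₂, mul_zero, add_zero, h₂ a, ← mul_assoc] at h2
      exact mul_right_cancel₀ n₂ h2
  have he : e ≠ 0 := by
    intro he
    obtain ⟨k, l, h0, h1, h2⟩ := hdiag' 1 1 one_ne_zero
    rw [hone, mul_one, he] at h2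
    rw [← h2, zero_mul, zero_add, hone, mul_one, he] at h1
    apply hd
    rw [h0, he1, he2, ← h2, ← h1, he]
    simp
  have hadd' : ∀ a c, a ≠ 0 → ρ (a + c) = ρ a + ρ c - ρ a * (e⁻¹ * d₀) * ρ c := by
    intro a c ha
    obtain ⟨k, l, h0, h1, h2⟩ := hdiag' c a ha
    have hk : k ≠ 0 := by rintro rfl; rw [zero_mul] at h2; exact he h2
    have hl : ρ a * e⁻¹ = k⁻¹ := by
      have : ρ a = k⁻¹ * e := by rw [h2, ← mul_assoc, inv_mul_cancel₀ hk, one_mul]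
      rw [this, mul_assoc, mul_inv_cancel₀ he, mul_one]
    rw [← mul_assoc, hl]
    apply mul_left_cancel₀ hk
    have : k * (k⁻¹ * d₀ * ρ c) = d₀ * ρ c := by
      rw [mul_assoc, ← mul_assoc, mul_inv_cancel₀ hk, one_mul]
    rw [mul_sub, mul_add, this, ← h2, h0, add_mul]
    nth_rewrite 1 [h1]
    abel
  have hk0 : e⁻¹ * d₀ = 0 := by
    by_contra hk
    obtain ⟨t, ht0, ht1⟩ := hD
    have e1 := hadd' 1 1 one_ne_zero
    have e2 := hadd' t t ht0
    have e3 : ρ (t + t) = ρ t * ρ (1 + 1) := by rw [← hmul, mul_add, mul_one]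
    rw [e2, e1, hone, one_mul, mul_one, mul_sub, mul_add, mul_one, sub_right_inj] at e3
    have : ρ t = 1 := by
      apply mul_left_cancel₀ (mul_ne_zero (hne t ht0) hk)
      rw [e3, mul_one]
    exact ht1 (hinj (this.trans hone.symm))
  refine ⟨⟨⟨⟨ρ, hone⟩, hmul⟩, hzero, ?_⟩, h₁, h₂⟩
  intro a c
  by_cases ha : a = 0
  · subst ha; simp [hzero]
  · have := hadd' a c ha
    simpa [hk0] using this

variable {D E W : Type*} [DivisionRing D] [DivisionRing E] [AddCommGroup W] [Module E W]

namespace IsPlaneLineation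

variable {F : D × D → W}

theorem comp (hF : IsPlaneLineation E F) (T : (D × D) ≃ₗ[D] (D × D)) :
    IsPlaneLineation E (F ∘ T) where
  line p v t hv := by
    have := hF.line (T p) (T v) t (by simpa using hv)
    simpa using this
  pair p q h := hF.pair _ _ (by simpa using h)
  noncollinear p q := by
    obtain ⟨r, hr⟩ := hF.noncollinear (T p) (T q)
    exact ⟨T.symm r, by simpa using hr⟩

theorem indep_common (hF : IsPlaneLineation E F) (hD : ∀ s : D, ∃ c, c ≠ 0 ∧ c ≠ s) {o : W}
    (ho0 : o ≠ 0) (ho : ∀ a a' b, a ≠ a' → o ∈ span E {F (a, b), F (a', b)}) (a b : D) :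
    LinearIndependent E ![o, F (a, b)] := by
  rw [LinearIndependent.pair_iff' ho0]
  intro r hr
  have hb : b + 1 ≠ b := by simp
  refine hF.notMem_span_horizontal hD (x := a) (zero_ne_one (α := D)) hb ?_
  rw [← hr]
  exact smul_mem _ _ (ho 0 1 (b + 1) zero_ne_one)

theorem exists_smul_eq (hF : IsPlaneLineation E F) (hD : ∀ s : D, ∃ c, c ≠ 0 ∧ c ≠ s) {o : W}
    (ho0 : o ≠ 0) (ho : ∀ a a' b, a ≠ a' → o ∈ span E {F (a, b), F (a', b)}) (a b : D) :
    ∃ x s : E, x ≠ 0 ∧ F (a, b) = x • (F (0, b) + s • o) := by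
  have h1 := span_pair_eq_of_mem (hF.indep_common hD ho0 ho 0 b) (ho 0 1 b zero_ne_one)
    (subset_span (by simp))
  have h2 : F (a, b) ∈ span E {F (0, b), F (1, b)} := by
    have := hF.line (0, b) (1, 0) a (by simp)
    simpa using this
  rw [h1] at h2
  obtain ⟨y, x, hyx⟩ := mem_span_pair.1 h2
  have hx : x ≠ 0 := by
    rintro rfl
    rw [zero_smul, add_zero] at hyx
    exact (LinearIndependent.pair_iff' ho0).1 (hF.indep_common hD ho0 ho a b) y hyx
  exact ⟨x, x⁻¹ * y, hx, by rw [← hyx, smul_add, smul_smul, ← mul_assoc, mul_inv_cancel₀ hx,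
    one_mul, add_comm]⟩

/-- A line-preserving map of affine planes is affine with respect to a suitable projective frame
of the target. -/
theorem exists_frame (hF : IsPlaneLineation E F)
    (hD : ∃ g h : D, g ≠ 0 ∧ g ≠ 1 ∧ h ≠ 0 ∧ h ≠ 1 ∧ g ≠ h) :
    ∃ (X Y : W) (ρ : D →+* E), ∀ a b, ∃ z : E, z ≠ 0 ∧
      F (a, b) = z • (F (0, 0) + ρ a • X + ρ b • Y) := by
  have hD3 : ∀ s : D, ∃ c, c ≠ 0 ∧ c ≠ s := by
    obtain ⟨g, h, hg0, hg1, -⟩ := hD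
    intro s
    by_cases hs : g = s
    · exact ⟨1, one_ne_zero, fun h' => hg1 (hs.trans h'.symm)⟩
    · exact ⟨g, hg0, hs⟩
  let T : (D × D) ≃ₗ[D] (D × D) :=
    { toFun := fun p => (p.1 + p.2, p.1)
      invFun := fun p => (p.2, p.1 - p.2)
      map_add' := fun p q => by ext <;> simp; abel
      map_smul' := fun r p => by ext <;> simp [mul_add]
      left_inv := fun p => by ext <;> simp
      right_inv := fun p => by ext <;> simp }
  have hS := hF.comp (LinearEquiv.prodComm D D D)
  obtain ⟨X, hX0, hX⟩ := hF.exists_common hD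
  obtain ⟨Y, hY0, hY'⟩ := hS.exists_common hD
  obtain ⟨d, hd0, hd'⟩ := (hF.comp T).exists_common hD
  have hY : ∀ b b' a, b ≠ b' → Y ∈ span E {F (a, b), F (a, b')} := fun b b' a h => hY' b b' a h
  have hd : ∀ a a' c, a ≠ a' → d ∈ span E {F (a + c, a), F (a' + c, a')} :=
    fun a a' c h => hd' a a' c h
  have fX := hF.exists_smul_eq hD3 hX0 hX
  have fY : ∀ a b, ∃ x s : E, x ≠ 0 ∧ F (a, b) = x • (F (a, 0) + s • Y) :=
    fun a b => hS.exists_smul_eq hD3 hY0 hY' b a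
  have hOX : span E {F (0, 0), F (1, 0)} = span E {X, F (0, 0)} :=
    span_pair_eq_of_mem (hF.indep_common hD3 hX0 hX 0 0) (hX 0 1 0 zero_ne_one)
      (subset_span (by simp))
  have hYnot : Y ∉ span E {X, F (0, 0)} := by
    intro hmem
    obtain ⟨x, s, -, h⟩ := fY 0 1
    refine hF.notMem_span_horizontal hD3 (x := 0) (zero_ne_one (α := D)) (zero_ne_one (α := D)) ?_
    rw [hOX, h]
    exact smul_mem _ _ (add_mem (subset_span (by simp)) (smul_mem _ _ hmem))
  have ind := indep_triple_of_notMem (hF.indep_common hD3 hX0 hX 0 0) hYnot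
  have ind' : ∀ x y z x' y' z' : E, x • F (0, 0) + y • X + z • Y =
      x' • F (0, 0) + y' • X + z' • Y → x = x' ∧ y = y' ∧ z = z' := by
    intro x y z x' y' z' h
    have := ind (y - y') (x - x') (z - z') (by
      simp only [sub_smul]
      rw [← sub_eq_zero] at h
      rw [← h]; abel)
    exact ⟨sub_eq_zero.1 this.2.1, sub_eq_zero.1 this.1, sub_eq_zero.1 this.2.2⟩
  choose x₁ σ₁ hx₁ hσ₁ using fun a => fX a 0
  choose x₂ σ₂ hx₂ hσ₂ using fun b => fY 0 b
  have hform : ∀ a b, ∃ z : E, z ≠ 0 ∧ F (a, b) = z • (F (0, 0) + σ₁ a • X + σ₂ b • Y) := by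
    intro a b
    obtain ⟨x, s, hx, h⟩ := fX a b
    obtain ⟨y, t, hy, h'⟩ := fY a b
    rw [hσ₂ b] at h
    rw [hσ₁ a] at h'
    have e := ind' (x * x₂ b) (x * s) (x * x₂ b * σ₂ b) (y * x₁ a) (y * x₁ a * σ₁ a) (y * t) (by
      have := h.symm.trans h'
      simp only [smul_add, smul_smul, mul_assoc] at this ⊢
      rw [add_right_comm, this])
    refine ⟨y * x₁ a, mul_ne_zero hy (hx₁ a), ?_⟩
    rw [h']
    simp only [smul_add, smul_smul, mul_assoc] at e ⊢
    rw [← e.2.2]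
    have e1 : x * (x₂ b * σ₂ b) = y * (x₁ a * σ₂ b) := by
      rw [← mul_assoc, e.1, mul_assoc]
    rw [e1]
  choose z hz hF' using hform
  have z₁ : σ₁ 0 = 0 := by
    have := ind' 1 0 0 (x₁ 0) (x₁ 0 * σ₁ 0) 0 (by
      have := hσ₁ 0
      rw [smul_add, smul_smul] at this
      rw [← this]; simp)
    exact (mul_eq_zero.1 this.2.1.symm).resolve_left (hx₁ 0)
  have z₂ : σ₂ 0 = 0 := by
    have := ind' 1 0 0 (x₂ 0) 0 (x₂ 0 * σ₂ 0) (by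
      have := hσ₂ 0
      rw [smul_add, smul_smul] at this
      simp only [zero_smul, add_zero, one_smul]; exact this)
    exact (mul_eq_zero.1 this.2.2.symm).resolve_left (hx₂ 0)
  have hprop : ∀ p q : D × D, p ≠ q → ¬ (σ₁ p.1 = σ₁ q.1 ∧ σ₂ p.2 = σ₂ q.2) := by
    rintro ⟨a, b⟩ ⟨a', b'⟩ hpq ⟨h1, h2⟩
    simp only at h1 h2
    have h3 := hF.pair _ _ hpq
    have h0 : F (a, b) ≠ 0 := h3.ne_zero 0
    rw [LinearIndependent.pair_iff' h0] at h3
    apply h3 (z a' b' * (z a b)⁻¹)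
    rw [hF' a b, hF' a' b', h1, h2, smul_smul, mul_assoc, inv_mul_cancel₀ (hz a b), mul_one]
  obtain ⟨ρ, hρ₁, hρ₂⟩ : ∃ ρ : D →+* E, (∀ a, σ₁ a = ρ a * σ₁ 1) ∧ ∀ a, σ₂ a = ρ a * σ₂ 1 := by
    obtain ⟨d₁, d₀, hd01⟩ : ∃ k l : E, k • F (0 + 0, 0) + l • F (1 + 0, 1) = d :=
      mem_span_pair.1 (hd 0 1 0 zero_ne_one)
    have hdexp : ∃ d₀ d₁ d₂ : E, d = d₀ • F (0, 0) + d₁ • X + d₂ • Y := by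
      rw [hF' (1 + 0) 1, add_zero] at hd01
      rw [← hd01]
      refine ⟨d₁ + d₀ * z 1 1, d₀ * z 1 1 * σ₁ 1, d₀ * z 1 1 * σ₂ 1, ?_⟩
      simp only [smul_add, smul_smul, add_smul, add_zero, mul_assoc]
      abel
    obtain ⟨d₀, d₁, d₂, hdd⟩ := hdexp
    refine exists_ringHom_of_coordinates (hD3 1) z₁ ?_ z₂ ?_ ?_ (d₀ := d₀) (d₁ := d₁) (d₂ := d₂)
      ?_ ?_
    · intro a a' h
      by_contra hne
      exact hprop (a, 0) (a', 0) (fun h' => hne (Prod.ext_iff.1 h').1) ⟨h, rfl⟩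
    · intro a a' h
      by_contra hne
      exact hprop (0, a) (0, a') (fun h' => hne (Prod.ext_iff.1 h').2) ⟨rfl, h⟩
    · intro v₁ v₂ t hv
      have := hF.line (0, 0) (v₁, v₂) t (fun h => hv (Prod.ext_iff.1 h).1)
      simp only [Prod.mk_zero_zero, zero_add, Prod.smul_mk, smul_eq_mul] at this
      obtain ⟨k, l, hkl⟩ := mem_span_pair.1 this
      rw [hF' v₁ v₂, hF' (t * v₁) (t * v₂)] at hkl
      set w := z (t * v₁) (t * v₂) with hw
      have hw0 : w ≠ 0 := hz _ _
      have e := ind' (k + l * z v₁ v₂) (l * z v₁ v₂ * σ₁ v₁) (l * z v₁ v₂ * σ₂ v₂) w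
        (w * σ₁ (t * v₁)) (w * σ₂ (t * v₂)) (by
          simp only [smul_add, smul_smul, mul_assoc, add_smul] at hkl ⊢
          rw [← hkl, Prod.mk_zero_zero]
          abel)
      refine ⟨w⁻¹ * (l * z v₁ v₂), ?_, ?_⟩
      · rw [mul_assoc, e.2.1, ← mul_assoc, inv_mul_cancel₀ hw0, one_mul]
      · rw [mul_assoc, e.2.2, ← mul_assoc, inv_mul_cancel₀ hw0, one_mul]
    · rintro ⟨rfl, rfl, rfl⟩
      apply hd0
      rw [hdd]; simp
    · intro c a a' haa
      obtain ⟨k, l, hkl⟩ := mem_span_pair.1 (hd a a' c haa)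
      rw [hF' (a + c) a, hF' (a' + c) a', hdd] at hkl
      have e := ind' d₀ d₁ d₂ (k * z (a + c) a + l * z (a' + c) a')
        (k * z (a + c) a * σ₁ (a + c) + l * z (a' + c) a' * σ₁ (a' + c))
        (k * z (a + c) a * σ₂ a + l * z (a' + c) a' * σ₂ a') (by
          simp only [smul_add, smul_smul, mul_assoc, add_smul] at hkl ⊢
          rw [← hkl]
          abel)
      exact ⟨_, _, e⟩
  refine ⟨σ₁ 1 • X, σ₂ 1 • Y, ρ, fun a b => ⟨z a b, hz a b, ?_⟩⟩
  rw [hF' a b, smul_smul, smul_smul, ← hρ₁, ← hρ₂]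

end IsPlaneLineation

end AffineForm

section Semilinear

open Submodule

variable {D E V W : Type*} [DivisionRing D] [DivisionRing E] [AddCommGroup V] [Module D V]
  [AddCommGroup W] [Module E W]

theorem LinearIndependent.pair_of_smul_left {a b : W} {k : E} (h : LinearIndependent E ![a, b])
    (hk : k ≠ 0) : LinearIndependent E ![k • a, b] := by
  rw [LinearIndependent.pair_iff] at h ⊢
  intro s t hst
  rw [smul_smul] at hst
  obtain ⟨h1, h2⟩ := h _ _ hst
  exact ⟨(mul_eq_zero.1 h1).resolve_right hk, h2⟩

theorem LinearIndependent.pair_of_add_smul_right {a b : W} (k : E)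
    (h : LinearIndependent E ![a, b]) : LinearIndependent E ![a, k • a + b] := by
  rw [LinearIndependent.pair_iff] at h ⊢
  intro s t hst
  rw [smul_add, smul_smul, ← add_assoc, ← add_smul] at hst
  obtain ⟨h1, rfl⟩ := h _ _ hst
  simpa using h1

theorem exists_smul_of_not_pair {a b : W} (ha : a ≠ 0) (hb : b ≠ 0)
    (h : ¬ LinearIndependent E ![a, b]) : ∃ k : E, k ≠ 0 ∧ b = k • a := by
  rw [LinearIndependent.pair_iff' ha] at h
  push Not at h
  obtain ⟨k, hk⟩ := h
  refine ⟨k, ?_, hk.symm⟩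
  rintro rfl
  exact hb (by rw [← hk, zero_smul])

/-- A map of vector spaces is a lineation when it is injective, fixes zero and maps lines into
lines. -/
structure IsLineation (D E : Type*) {V W : Type*} [DivisionRing D] [DivisionRing E]
    [AddCommGroup V] [Module D V] [AddCommGroup W] [Module E W] (f : V → W) : Prop where
  injective : Function.Injective f
  map_zero : f 0 = 0
  line : ∀ y v : V, ∃ q : W, ∀ t : D, ∃ c : E, f (y + t • v) = f y + c • q

namespace IsLineation

variable {f : V → W}

theorem ne_zero (hf : IsLineation D E f) {y : V} (hy : y ≠ 0) : f y ≠ 0 :=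
  fun h => hy (hf.injective (h.trans hf.map_zero.symm))

theorem exists_combination (hf : IsLineation D E f) (y : V) {v : V} (hv : v ≠ 0) (t : D) :
    ∃ k : E, f (y + t • v) = (1 - k) • f y + k • f (y + v) := by
  obtain ⟨q, hq⟩ := hf.line y v
  obtain ⟨c, hc⟩ := hq t
  obtain ⟨c₁, hc₁⟩ := hq 1
  rw [one_smul] at hc₁
  have hc₁0 : c₁ ≠ 0 := by
    rintro rfl
    rw [zero_smul, add_zero] at hc₁
    exact hv (by simpa using hf.injective hc₁)
  refine ⟨c * c₁⁻¹, ?_⟩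
  rw [hc, hc₁, smul_add, smul_smul, mul_assoc, inv_mul_cancel₀ hc₁0, mul_one, ← add_assoc,
    ← add_smul, sub_add_cancel, one_smul]

theorem exists_smul (hf : IsLineation D E f) (v : V) (t : D) : ∃ k : E, f (t • v) = k • f v := by
  by_cases hv : v = 0
  · exact ⟨0, by rw [hv, smul_zero, hf.map_zero, smul_zero]⟩
  · obtain ⟨k, hk⟩ := hf.exists_combination 0 hv t
    exact ⟨k, by simpa [hf.map_zero] using hk⟩

theorem pair_of_pair (hf : IsLineation D E f) {y z : V} (h : LinearIndependent E ![f y, f z]) :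
    LinearIndependent D ![y, z] := by
  have hy : y ≠ 0 := by
    rintro rfl
    exact h.ne_zero 0 (by simp [hf.map_zero])
  have hy' : f y ≠ 0 := h.ne_zero 0
  rw [LinearIndependent.pair_iff' hy]
  rintro t rfl
  obtain ⟨k, hk⟩ := hf.exists_smul y t
  exact (LinearIndependent.pair_iff' hy').1 h k hk.symm

theorem isPlaneLineation (hf : IsLineation D E f) {y z : V}
    (h : LinearIndependent E ![f y, f z]) :
    IsPlaneLineation E fun p : D × D => ((1 : E), f (p.1 • y + p.2 • z)) := by
  have hyz := LinearIndependent.pair_iff.1 (hf.pair_of_pair h)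
  have hpair : ∀ u v : W, u ≠ v → LinearIndependent E ![((1 : E), u), ((1 : E), v)] := by
    intro u v huv
    rw [LinearIndependent.pair_iff]
    intro s t hst
    simp only [Prod.smul_mk, Prod.mk_add_mk, smul_eq_mul, mul_one, Prod.mk_eq_zero] at hst
    obtain ⟨h1, h2⟩ := hst
    have hs : s = -t := eq_neg_of_add_eq_zero_left h1
    rw [hs, neg_smul, neg_add_eq_zero] at h2
    have ht : t = 0 := by
      by_contra ht
      exact huv (smul_right_injective W ht h2)
    exact ⟨by rw [hs, ht, neg_zero], ht⟩
  refine ⟨?_, ?_, ?_⟩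
  · rintro ⟨p₁, p₂⟩ ⟨v₁, v₂⟩ t hv
    have hv' : v₁ • y + v₂ • z ≠ 0 := fun h0 => hv (Prod.ext (hyz _ _ h0).1 (hyz _ _ h0).2)
    obtain ⟨k, hk⟩ := hf.exists_combination (p₁ • y + p₂ • z) hv' t
    refine mem_span_pair.2 ⟨1 - k, k, ?_⟩
    have e1 : p₁ • y + p₂ • z + t • (v₁ • y + v₂ • z) = (p₁ + t * v₁) • y + (p₂ + t * v₂) • z := by
      simp only [add_smul, smul_add, smul_smul]; abel
    have e2 : p₁ • y + p₂ • z + (v₁ • y + v₂ • z) = (p₁ + v₁) • y + (p₂ + v₂) • z := by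
      simp only [add_smul]; abel
    rw [e1, e2] at hk
    simp [hk]
  · rintro ⟨p₁, p₂⟩ ⟨q₁, q₂⟩ hpq
    refine hpair _ _ fun h' => hpq ?_
    have h'' := hf.injective h'
    rw [← sub_eq_zero, add_sub_add_comm, ← sub_smul, ← sub_smul] at h''
    obtain ⟨h1, h2⟩ := hyz _ _ h''
    exact Prod.ext (sub_eq_zero.1 h1) (sub_eq_zero.1 h2)
  · intro p q
    by_contra! hall
    have h0 := hall (0, 0)
    have h1 := hall (1, 0)
    have h2 := hall (0, 1)
    simp only [zero_smul, one_smul, add_zero, zero_add, hf.map_zero] at h0 h1 h2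
    have hy : f y ≠ 0 := h.ne_zero 0
    rw [span_pair_eq_of_mem (hpair 0 (f y) hy.symm) h0 h1] at h2
    obtain ⟨a, b, hab⟩ := mem_span_pair.1 h2
    simp only [Prod.smul_mk, Prod.mk_add_mk, smul_zero, zero_add, Prod.mk.injEq] at hab
    exact (LinearIndependent.pair_iff' hy).1 h b hab.2

theorem exists_ringHom_of_pair (hf : IsLineation D E f)
    (hsurj : ∀ ρ : D →+* E, Function.Surjective ρ)
    (hD : ∃ g h : D, g ≠ 0 ∧ g ≠ 1 ∧ h ≠ 0 ∧ h ≠ 1 ∧ g ≠ h) {y z : V}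
    (h : LinearIndependent E ![f y, f z]) :
    ∃ ρ : D →+* E, ∀ a b : D, f (a • y + b • z) = ρ a • f y + ρ b • f z := by
  obtain ⟨X, Y, ρ, hρ⟩ := (hf.isPlaneLineation h).exists_frame hD
  simp only [zero_smul, add_zero, hf.map_zero] at hρ
  have hvanish : ∀ κ : E, (∀ a, ∃ z : E, z ≠ 0 ∧ 1 = z * (1 + ρ a * κ)) → κ = 0 := by
    intro κ hκ
    by_contra h0
    obtain ⟨a, ha⟩ := hsurj ρ (-κ⁻¹)
    obtain ⟨z, -, hz⟩ := hκ a
    rw [ha, neg_mul, inv_mul_cancel₀ h0, add_neg_cancel, mul_zero] at hz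
    exact one_ne_zero hz
  have hX : X.1 = 0 := by
    refine hvanish _ fun a => ?_
    obtain ⟨z, hz, e⟩ := hρ a 0
    exact ⟨z, hz, by simpa [mul_add] using congrArg Prod.fst e⟩
  have hY : Y.1 = 0 := by
    refine hvanish _ fun a => ?_
    obtain ⟨z, hz, e⟩ := hρ 0 a
    exact ⟨z, hz, by simpa [mul_add] using congrArg Prod.fst e⟩
  have hlin : ∀ a b : D, f (a • y + b • z) = ρ a • X.2 + ρ b • Y.2 := by
    intro a b
    obtain ⟨w, -, e⟩ := hρ a b
    have e1 : (1 : E) = w := by simpa [hX, hY] using congrArg Prod.fst e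
    have e2 := congrArg Prod.snd e
    rw [← e1] at e2
    simpa using e2
  have hX' : X.2 = f y := by simpa using (hlin 1 0).symm
  have hY' : Y.2 = f z := by simpa using (hlin 0 1).symm
  exact ⟨ρ, fun a b => by rw [hlin, hX', hY']⟩

/-- The fundamental theorem of affine geometry for lineations, when all ring homomorphisms between
the ground division rings are surjective. -/
theorem exists_semilinear (hf : IsLineation D E f)
    (hsurj : ∀ ρ : D →+* E, Function.Surjective ρ)
    (hD : ∃ g h : D, g ≠ 0 ∧ g ≠ 1 ∧ h ≠ 0 ∧ h ≠ 1 ∧ g ≠ h)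
    (hpair : ∃ y z : V, LinearIndependent E ![f y, f z]) :
    ∃ σ : D →+* E, (∀ y z, f (y + z) = f y + f z) ∧ ∀ (t : D) y, f (t • y) = σ t • f y := by
  obtain ⟨y₁, y₂, h₁₂⟩ := hpair
  have key : ∀ {y z}, LinearIndependent E ![f y, f z] →
      ∃ ρ : D →+* E, ∀ a b : D, f (a • y + b • z) = ρ a • f y + ρ b • f z :=
    fun h => hf.exists_ringHom_of_pair hsurj hD h
  have hadd : ∀ {y z}, LinearIndependent E ![f y, f z] → f (y + z) = f y + f z := by
    intro y z h
    obtain ⟨ρ, hρ⟩ := key h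
    simpa using hρ 1 1
  have h₁ : f y₁ ≠ 0 := h₁₂.ne_zero 0
  have hex : ∀ y, f y ≠ 0 → ∃ w, LinearIndependent E ![f y, f w] := by
    intro y hy
    by_cases h : LinearIndependent E ![f y₁, f y]
    · exact ⟨y₁, LinearIndependent.pair_symm_iff.1 h⟩
    · obtain ⟨k, hk, e⟩ := exists_smul_of_not_pair h₁ hy h
      exact ⟨y₂, by rw [e]; exact h₁₂.pair_of_smul_left hk⟩
  obtain ⟨σ, hσ⟩ := key h₁₂
  refine ⟨σ, ?_, ?_⟩
  · intro y z
    by_cases hy : y = 0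
    · rw [hy, hf.map_zero, zero_add, zero_add]
    by_cases hz : z = 0
    · rw [hz, hf.map_zero, add_zero, add_zero]
    by_cases hyz : LinearIndependent E ![f y, f z]
    · exact hadd hyz
    obtain ⟨k, hk, ek⟩ := exists_smul_of_not_pair (hf.ne_zero hy) (hf.ne_zero hz) hyz
    have hfin : ∀ w, LinearIndependent E ![f y, f w] →
        f (y + z + w) = f y + f z + f w := by
      intro w hw
      have hzw : f (z + w) = f z + f w := hadd (by rw [ek]; exact hw.pair_of_smul_left hk)
      rw [add_assoc, hadd, hzw, add_assoc]
      rw [hzw, ek]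
      exact hw.pair_of_add_smul_right k
    obtain ⟨w₀, hw₀⟩ := hex y (hf.ne_zero hy)
    by_cases hs : y + z = 0
    · have := hfin w₀ hw₀
      rw [hs, zero_add, eq_comm, add_eq_right] at this
      rw [hs, hf.map_zero, this]
    obtain ⟨w, hw, hw'⟩ : ∃ w, LinearIndependent E ![f y, f w] ∧
        LinearIndependent E ![f (y + z), f w] := by
      by_cases h : LinearIndependent E ![f w₀, f (y + z)]
      · exact ⟨w₀, hw₀, LinearIndependent.pair_symm_iff.1 h⟩
      · obtain ⟨l, hl, el⟩ := exists_smul_of_not_pair (hw₀.ne_zero 1) (hf.ne_zero hs) h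
        have e : f (y + w₀) = f y + f w₀ := hadd hw₀
        refine ⟨y + w₀, ?_, ?_⟩
        · rw [e]
          simpa using hw₀.pair_of_add_smul_right 1
        · rw [e, el]
          refine LinearIndependent.pair_of_smul_left ?_ hl
          rw [add_comm]
          simpa using (LinearIndependent.pair_symm_iff.1 hw₀).pair_of_add_smul_right 1
    have e := hfin w hw
    rw [hadd hw'] at e
    exact add_right_cancel e
  · have hprop : ∀ {y z}, LinearIndependent E ![f y, f z] → (∀ t : D, f (t • y) = σ t • f y) →
        ∀ t : D, f (t • z) = σ t • f z := by
      intro y z h hy t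
      obtain ⟨ρ, hρ⟩ := key h
      have e1 : f (t • y) = ρ t • f y := by simpa using hρ t 0
      have e2 : f (t • z) = ρ t • f z := by simpa using hρ 0 t
      have hy0 : f y ≠ 0 := h.ne_zero 0
      rw [hy t] at e1
      rw [e2, smul_left_injective E hy0 e1]
    have s₁ : ∀ t : D, f (t • y₁) = σ t • f y₁ := fun t => by simpa using hσ t 0
    have s₂ : ∀ t : D, f (t • y₂) = σ t • f y₂ := hprop h₁₂ s₁
    intro t y
    by_cases hy : y = 0
    · rw [hy, smul_zero, hf.map_zero, smul_zero]
    by_cases h : LinearIndependent E ![f y₁, f y]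
    · exact hprop h s₁ t
    · obtain ⟨k, hk, e⟩ := exists_smul_of_not_pair h₁ (hf.ne_zero hy) h
      refine hprop (LinearIndependent.pair_symm_iff.1 ?_) s₂ t
      rw [e]
      exact h₁₂.pair_of_smul_left hk

end IsLineation

end Semilinear

section Dyad

open MulOpposite

variable {ι κ D : Type*} [DivisionRing D]

/-- A dyad is a product of a column vector with a row vector. -/
def IsDyad (A : Matrix ι κ D) : Prop := ∃ x y, A = vecMulVec x y

/-- The columns of `A` are right multiples of `p`. -/
def InColumn (p : ι → D) (A : Matrix ι κ D) : Prop := ∃ v, A = vecMulVec p v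

/-- The rows of `A` are left multiples of `q`. -/
def InRow (q : κ → D) (A : Matrix ι κ D) : Prop := ∃ u, A = vecMulVec u q

theorem vecMulVec_zero_right (x : ι → D) : vecMulVec x (0 : κ → D) = 0 := by
  ext i j
  simp [vecMulVec_apply]

theorem inColumn_zero (p : ι → D) : InColumn p (0 : Matrix ι κ D) :=
  ⟨0, (vecMulVec_zero_right p).symm⟩

theorem inRow_zero (q : κ → D) : InRow q (0 : Matrix ι κ D) := ⟨0, (zero_vecMulVec q).symm⟩

theorem vecMulVec_smul_eq_op_smul (x : ι → D) (c : D) (y : κ → D) :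
    vecMulVec x (c • y) = vecMulVec (op c • x) y := by
  ext i j
  simp [vecMulVec_apply, mul_assoc]

theorem vecMulVec_right_injective {x : ι → D} (hx : x ≠ 0) :
    Function.Injective (vecMulVec x : (κ → D) → Matrix ι κ D) := by
  obtain ⟨i, hi⟩ := Function.ne_iff.1 hx
  intro y y' h
  ext j
  exact mul_left_cancel₀ hi (congrFun (congrFun h i) j)

theorem vecMulVec_left_injective {y : κ → D} (hy : y ≠ 0) :
    Function.Injective (fun x : ι → D => vecMulVec x y) := by
  obtain ⟨j, hj⟩ := Function.ne_iff.1 hy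
  intro x x' h
  ext i
  exact mul_right_cancel₀ hj (congrFun (congrFun h i) j)

theorem vecMulVec_ne_zero_of_ne {x : ι → D} {y : κ → D} (hx : x ≠ 0) (hy : y ≠ 0) :
    vecMulVec x y ≠ 0 := fun h =>
  hy (vecMulVec_right_injective hx (h.trans (vecMulVec_zero_right x).symm))

theorem left_ne_zero_of_vecMulVec {x : ι → D} {y : κ → D} (h : vecMulVec x y ≠ 0) : x ≠ 0 := by
  rintro rfl; exact h (zero_vecMulVec y)

theorem right_ne_zero_of_vecMulVec {x : ι → D} {y : κ → D} (h : vecMulVec x y ≠ 0) : y ≠ 0 := by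
  rintro rfl; exact h (vecMulVec_zero_right x)

theorem exists_smul_of_vecMulVec_eq {x x' : ι → D} {y y' : κ → D} (hx : x ≠ 0)
    (h : vecMulVec x y = vecMulVec x' y') : ∃ c : D, y = c • y' := by
  obtain ⟨i, hi⟩ := Function.ne_iff.1 hx
  refine ⟨(x i)⁻¹ * x' i, ?_⟩
  ext j
  have : x i * y j = x' i * y' j := congrFun (congrFun h i) j
  rw [Pi.smul_apply, smul_eq_mul, mul_assoc, ← this, ← mul_assoc, inv_mul_cancel₀ hi, one_mul]

theorem exists_op_smul_of_vecMulVec_eq {x x' : ι → D} {y y' : κ → D} (hy : y ≠ 0)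
    (h : vecMulVec x y = vecMulVec x' y') : ∃ c : D, x = op c • x' := by
  obtain ⟨j, hj⟩ := Function.ne_iff.1 hy
  refine ⟨y' j * (y j)⁻¹, ?_⟩
  ext i
  have : x i * y j = x' i * y' j := congrFun (congrFun h i) j
  rw [Pi.smul_apply, op_smul_eq_mul, ← mul_assoc, ← this, mul_assoc, mul_inv_cancel₀ hj, mul_one]

theorem isDyad_zero : IsDyad (0 : Matrix ι κ D) := ⟨0, 0, (vecMulVec_zero_right 0).symm⟩

theorem isDyad_vecMulVec (x : ι → D) (y : κ → D) : IsDyad (vecMulVec x y) := ⟨x, y, rfl⟩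

theorem InColumn.trans {p p' : ι → D} {A B : Matrix ι κ D} (hA : A ≠ 0) (h : InColumn p A)
    (h' : InColumn p' A) (hB : InColumn p' B) : InColumn p B := by
  obtain ⟨v, rfl⟩ := h
  obtain ⟨v', hv⟩ := h'
  obtain ⟨w, rfl⟩ := hB
  have hv' : v' ≠ 0 := right_ne_zero_of_vecMulVec (hv ▸ hA)
  obtain ⟨c, rfl⟩ := exists_op_smul_of_vecMulVec_eq hv' hv.symm
  exact ⟨c • w, (vecMulVec_smul_eq_op_smul _ _ _).symm⟩

theorem InRow.trans {q q' : κ → D} {A B : Matrix ι κ D} (hA : A ≠ 0) (h : InRow q A)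
    (h' : InRow q' A) (hB : InRow q' B) : InRow q B := by
  obtain ⟨u, rfl⟩ := h
  obtain ⟨u', hu⟩ := h'
  obtain ⟨w, rfl⟩ := hB
  have hu' : u' ≠ 0 := left_ne_zero_of_vecMulVec (hu ▸ hA)
  obtain ⟨c, rfl⟩ := exists_smul_of_vecMulVec_eq hu' hu.symm
  exact ⟨op c • w, vecMulVec_smul_eq_op_smul _ _ _⟩

theorem inColumn_or_inRow_of_add {A : Matrix ι κ D} {u : ι → D} {v : κ → D} (hA : IsDyad A)
    (hu : u ≠ 0) (hv : v ≠ 0) (h : IsDyad (A + vecMulVec u v)) : InColumn u A ∨ InRow v A := by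
  obtain ⟨p, q, rfl⟩ := hA
  obtain ⟨r, s, h⟩ := h
  by_cases hvq : LinearIndependent D ![v, q]
  · left
    have hij : ∀ i, p i • q + u i • v = r i • s := fun i =>
      funext fun j => congrFun (congrFun h i) j
    obtain ⟨i, hi⟩ := Function.ne_iff.1 hu
    have hr : r i ≠ 0 := by
      intro hr
      have := hij i
      rw [hr, zero_smul, add_comm] at this
      exact hi (LinearIndependent.pair_iff.1 hvq _ _ this).1
    obtain ⟨a, b, hs⟩ : ∃ a b : D, s = a • q + b • v := by
      refine ⟨(r i)⁻¹ * p i, (r i)⁻¹ * u i, ?_⟩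
      rw [mul_smul, mul_smul, ← smul_add, hij i, smul_smul, inv_mul_cancel₀ hr, one_smul]
    have hcoef : ∀ k, p k = r k * a ∧ u k = r k * b := by
      intro k
      have := hij k
      rw [hs, smul_add, smul_smul, smul_smul, ← sub_eq_zero, add_sub_add_comm, ← sub_smul,
        ← sub_smul, add_comm] at this
      obtain ⟨h1, h2⟩ := LinearIndependent.pair_iff.1 hvq _ _ this
      exact ⟨sub_eq_zero.1 h2, sub_eq_zero.1 h1⟩
    have hb : b ≠ 0 := by
      rintro rfl
      exact hi (by simpa using (hcoef i).2)
    refine ⟨(b⁻¹ * a) • q, ?_⟩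
    rw [vecMulVec_smul_eq_op_smul]
    congr 1
    ext k
    rw [Pi.smul_apply, op_smul_eq_mul, (hcoef k).2, (hcoef k).1, mul_assoc, ← mul_assoc b,
      mul_inv_cancel₀ hb, one_mul]
  · right
    rw [LinearIndependent.pair_iff' hv] at hvq
    push Not at hvq
    obtain ⟨c, rfl⟩ := hvq
    exact ⟨_, vecMulVec_smul_eq_op_smul _ _ _⟩

theorem inColumn_or_inRow_of_sub {A : Matrix ι κ D} {u : ι → D} {v : κ → D} (hA : IsDyad A)
    (hu : u ≠ 0) (hv : v ≠ 0) (h : IsDyad (A - vecMulVec u v)) : InColumn u A ∨ InRow v A := by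
  have h' : IsDyad (A + vecMulVec (-u) v) := by rwa [neg_vecMulVec, ← sub_eq_add_neg]
  obtain ⟨w, hw⟩ | h := inColumn_or_inRow_of_add hA (neg_ne_zero.2 hu) hv h'
  · exact Or.inl ⟨-w, by rw [hw, neg_vecMulVec, vecMulVec_neg]⟩
  · exact Or.inr h

/-- A clique of dyads containing zero is contained in a common column or a common row. -/
theorem exists_inColumn_or_inRow {T : Type*} {s : T → Matrix ι κ D} (hs : ∀ t, IsDyad (s t))
    (hsub : ∀ t t', IsDyad (s t - s t')) (hne : ∃ t, s t ≠ 0) :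
    (∃ p, p ≠ 0 ∧ ∀ t, InColumn p (s t)) ∨ ∃ q, q ≠ 0 ∧ ∀ t, InRow q (s t) := by
  obtain ⟨t₀, h₀⟩ := hne
  obtain ⟨p, q, hpq⟩ := hs t₀
  have hp : p ≠ 0 := left_ne_zero_of_vecMulVec (hpq ▸ h₀)
  have hq : q ≠ 0 := right_ne_zero_of_vecMulVec (hpq ▸ h₀)
  by_contra! hcon
  obtain ⟨a, ha⟩ := hcon.1 p hp
  obtain ⟨b, hb⟩ := hcon.2 q hq
  have hra : InRow q (s a) :=
    (inColumn_or_inRow_of_sub (hs a) hp hq (hpq ▸ hsub a t₀)).resolve_left ha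
  have hcb : InColumn p (s b) :=
    (inColumn_or_inRow_of_sub (hs b) hp hq (hpq ▸ hsub b t₀)).resolve_right hb
  obtain ⟨v, hv⟩ := hcb
  have hv0 : v ≠ 0 := by
    rintro rfl
    exact hb (by rw [hv, vecMulVec_zero_right]; exact inRow_zero q)
  have ha0 : s a ≠ 0 := fun h => ha (h ▸ inColumn_zero p)
  obtain h | h := inColumn_or_inRow_of_sub (hs a) hp hv0 (hv ▸ hsub a b)
  · exact ha h
  · exact hb (hra.trans ha0 h ⟨p, hv⟩)

/-- A map of two vector arguments into dyads behaving like the restriction of a non-degenerate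
graph homomorphism to the dyads. -/
structure IsDyadMap {X Y : Type*} [Zero X] [Zero Y] (ψ : X → Y → Matrix ι κ D) : Prop where
  isDyad : ∀ x y, IsDyad (ψ x y)
  ne_zero : ∀ x y, x ≠ 0 → y ≠ 0 → ψ x y ≠ 0
  sub_left : ∀ x x' y, IsDyad (ψ x y - ψ x' y)
  sub_right : ∀ x y y', IsDyad (ψ x y - ψ x y')
  zero_left : ∀ y, ψ 0 y = 0
  zero_right : ∀ x, ψ x 0 = 0
  nondeg : ∀ p q, p ≠ 0 → q ≠ 0 → ∃ x y, ¬ InColumn p (ψ x y) ∧ ¬ InRow q (ψ x y)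

/-- The first argument determines the column and the second argument determines the row. -/
structure IsStandard {X Y : Type*} [Zero X] [Zero Y] (ψ : X → Y → Matrix ι κ D) : Prop where
  column : ∀ x, x ≠ 0 → ∃ p, p ≠ 0 ∧ ∀ y, InColumn p (ψ x y)
  row : ∀ y, y ≠ 0 → ∃ q, q ≠ 0 ∧ ∀ x, InRow q (ψ x y)

namespace IsDyadMap

variable {X Y : Type*} [Zero X] [Zero Y] {ψ : X → Y → Matrix ι κ D}

theorem swap (h : IsDyadMap ψ) : IsDyadMap fun y x => ψ x y where
  isDyad y x := h.isDyad x y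
  ne_zero y x hy hx := h.ne_zero x y hx hy
  sub_left y y' x := h.sub_right x y y'
  sub_right y x x' := h.sub_left x x' y
  zero_left x := h.zero_right x
  zero_right y := h.zero_left y
  nondeg p q hp hq := by
    obtain ⟨x, y, hxy⟩ := h.nondeg p q hp hq
    exact ⟨y, x, hxy⟩

theorem column_or_row [Nontrivial Y] (h : IsDyadMap ψ) {x : X} (hx : x ≠ 0) :
    (∃ p, p ≠ 0 ∧ ∀ y, InColumn p (ψ x y)) ∨ ∃ q, q ≠ 0 ∧ ∀ y, InRow q (ψ x y) := by
  obtain ⟨y, hy⟩ := exists_ne (0 : Y)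
  exact exists_inColumn_or_inRow (h.isDyad x) (h.sub_right x) ⟨y, h.ne_zero x y hx hy⟩

theorem not_column_and_row [Nontrivial X] (h : IsDyadMap ψ) {x x' : X} (hx : x ≠ 0) (hx' : x' ≠ 0)
    {p : ι → D} {q : κ → D} (hp : p ≠ 0) (hq : q ≠ 0) (hc : ∀ y, InColumn p (ψ x y))
    (hr : ∀ y, InRow q (ψ x' y)) : False := by
  obtain ⟨z, y, h1, h2⟩ := h.nondeg p q hp hq
  have hy : y ≠ 0 := by
    rintro rfl
    exact h1 (h.zero_right z ▸ inColumn_zero p)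
  obtain ⟨p', -, hp'⟩ | ⟨q', -, hq'⟩ := h.swap.column_or_row hy
  · exact h1 ((hc y).trans (h.ne_zero x y hx hy) (hp' x) (hp' z))
  · exact h2 ((hr y).trans (h.ne_zero x' y hx' hy) (hq' x') (hq' z))

theorem forall_column_or_forall_row [Nontrivial X] [Nontrivial Y] (h : IsDyadMap ψ) :
    (∀ x, x ≠ 0 → ∃ p, p ≠ 0 ∧ ∀ y, InColumn p (ψ x y)) ∨
      ∀ x, x ≠ 0 → ∃ q, q ≠ 0 ∧ ∀ y, InRow q (ψ x y) := by
  by_contra! hcon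
  obtain ⟨⟨x, hx, hx'⟩, z, hz, hz'⟩ := hcon
  obtain ⟨p, hp, hc⟩ | ⟨p, hp, hc⟩ := h.column_or_row hz
  · obtain ⟨q, hq, hr⟩ | ⟨q, hq, hr⟩ := h.column_or_row hx
    · obtain ⟨y, hy⟩ := hx' q hq
      exact hy (hr y)
    · exact h.not_column_and_row hz hx hp hq hc hr
  · obtain ⟨y, hy⟩ := hz' p hp
    exact hy (hc y)

theorem isStandard_or_swap [Nontrivial X] [Nontrivial Y] [Nonempty ι] [Nonempty κ]
    (h : IsDyadMap ψ) : IsStandard ψ ∨ IsStandard fun y x => ψ x y := by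
  obtain ⟨x₀, hx₀⟩ := exists_ne (0 : X)
  obtain ⟨y₀, hy₀⟩ := exists_ne (0 : Y)
  have h₀ := h.ne_zero x₀ y₀ hx₀ hy₀
  obtain hc | hr := h.forall_column_or_forall_row
  · obtain hc' | hr' := h.swap.forall_column_or_forall_row
    · exfalso
      obtain ⟨p, hp, hp'⟩ := hc x₀ hx₀
      obtain ⟨q, hq⟩ := exists_ne (0 : κ → D)
      obtain ⟨x, y, h1, -⟩ := h.nondeg p q hp hq
      have hy : y ≠ 0 := by
        rintro rfl
        exact h1 (h.zero_right x ▸ inColumn_zero p)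
      obtain ⟨r, -, hr⟩ := hc' y hy
      exact h1 ((hp' y).trans (h.ne_zero x₀ y hx₀ hy) (hr x₀) (hr x))
    · exact Or.inl ⟨hc, hr'⟩
  · obtain hc' | hr' := h.swap.forall_column_or_forall_row
    · exact Or.inr ⟨hc', hr⟩
    · exfalso
      obtain ⟨q, hq, hq'⟩ := hr x₀ hx₀
      obtain ⟨p, hp⟩ := exists_ne (0 : ι → D)
      obtain ⟨x, y, -, h1⟩ := h.nondeg p q hp hq
      have hy : y ≠ 0 := by
        rintro rfl
        exact h1 (h.zero_right x ▸ inRow_zero q)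
      obtain ⟨r, -, hr⟩ := hr' y hy
      exact h1 ((hq' y).trans (h.ne_zero x₀ y hx₀ hy) (hr x₀) (hr x))

end IsDyadMap

end Dyad

section DyadHom

open MulOpposite

variable {D E ι κ ι' κ' : Type*} [DivisionRing D] [DivisionRing E]

/-- A non-degenerate graph homomorphism fixing zero, expressed in terms of dyads. -/
structure IsDyadHom (φ : Matrix ι κ D → Matrix ι' κ' E) : Prop where
  map_zero : φ 0 = 0
  ne : ∀ X Y, X ≠ Y → IsDyad (X - Y) → φ X ≠ φ Y
  isDyad : ∀ X Y, IsDyad (X - Y) → IsDyad (φ X - φ Y)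
  nondeg : ∀ A, IsDyad A → ∀ p q, p ≠ 0 → q ≠ 0 → ∃ X, IsDyad (X - A) ∧
    ¬ InColumn p (φ X - φ A) ∧ ¬ InRow q (φ X - φ A)

theorem exists_smul_eq_of_forall {V W : Type*} [AddCommGroup V] [AddCommGroup W] [Module E W]
    {f g : V → W} (hf : ∀ y z, f (y + z) = f y + f z) (hg : ∀ y z, g (y + z) = g y + g z)
    (hf0 : ∀ y, y ≠ 0 → f y ≠ 0) (hpair : ∃ y z, LinearIndependent E ![f y, f z])
    (h : ∀ y, ∃ c : E, g y = c • f y) : ∃ c : E, ∀ y, g y = c • f y := by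
  obtain ⟨y₁, y₂, h₁₂⟩ := hpair
  choose c hc using h
  have key : ∀ {y z}, LinearIndependent E ![f y, f z] → c y = c z := by
    intro y z hyz
    have e := hc (y + z)
    rw [hg, hc, hc z, hf, smul_add, ← sub_eq_zero, add_sub_add_comm, ← sub_smul, ← sub_smul] at e
    obtain ⟨e1, e2⟩ := LinearIndependent.pair_iff.1 hyz _ _ e
    rw [sub_eq_zero.1 e1, sub_eq_zero.1 e2]
  refine ⟨c y₁, fun y => ?_⟩
  have h₁ : f y₁ ≠ 0 := h₁₂.ne_zero 0
  by_cases hy : y = 0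
  · have f0 : f 0 = 0 := by simpa using hf 0 0
    rw [hc, hy, f0, smul_zero, smul_zero]
  by_cases hyy : LinearIndependent E ![f y₁, f y]
  · rw [hc, key hyy]
  · obtain ⟨k, hk, e⟩ := exists_smul_of_not_pair h₁ (hf0 y hy) hyy
    rw [hc, key h₁₂, key (y := y) (z := y₂)]
    rw [e]
    exact h₁₂.pair_of_smul_left hk

namespace IsDyadHom

variable {φ : Matrix ι κ D → Matrix ι' κ' E}

theorem isDyadMap (h : IsDyadHom φ) {A : Matrix ι κ D} (hA : IsDyad A) :
    IsDyadMap fun (x : ι → D) (y : κ → D) => φ (A + vecMulVec x y) - φ A where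
  isDyad x y := h.isDyad _ _ (by rw [add_sub_cancel_left]; exact isDyad_vecMulVec x y)
  ne_zero x y hx hy := by
    rw [sub_ne_zero]
    refine h.ne _ _ ?_ (by rw [add_sub_cancel_left]; exact isDyad_vecMulVec x y)
    rw [ne_eq, add_eq_left]
    exact vecMulVec_ne_zero_of_ne hx hy
  sub_left x x' y := by
    rw [sub_sub_sub_cancel_right]
    refine h.isDyad _ _ ?_
    rw [add_sub_add_left_eq_sub, ← sub_vecMulVec]
    exact isDyad_vecMulVec _ _
  sub_right x y y' := by
    rw [sub_sub_sub_cancel_right]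
    refine h.isDyad _ _ ?_
    rw [add_sub_add_left_eq_sub, ← vecMulVec_sub]
    exact isDyad_vecMulVec _ _
  zero_left y := by rw [zero_vecMulVec, add_zero, sub_self]
  zero_right x := by rw [vecMulVec_zero_right, add_zero, sub_self]
  nondeg p q hp hq := by
    obtain ⟨X, ⟨x, y, hX⟩, h1, h2⟩ := h.nondeg A hA p q hp hq
    refine ⟨x, y, ?_⟩
    rw [← hX, add_sub_cancel]
    exact ⟨h1, h2⟩

theorem isDyadMap_zero (h : IsDyadHom φ) :
    IsDyadMap fun (x : ι → D) (y : κ → D) => φ (vecMulVec x y) := by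
  have := h.isDyadMap isDyad_zero
  simpa only [zero_add, h.map_zero, sub_zero] using this

variable [Nonempty ι] [Nonempty κ] [Nonempty ι'] [Nonempty κ']

theorem isStandard_of_isStandard_zero (h : IsDyadHom φ)
    (hs : IsStandard fun (x : ι → D) (y : κ → D) => φ (vecMulVec x y)) {x₀ : ι → D} (hx : x₀ ≠ 0)
    (y₀ : κ → D) :
    IsStandard fun x y => φ (vecMulVec x₀ y₀ + vecMulVec x y) - φ (vecMulVec x₀ y₀) := by
  by_cases hy : y₀ = 0
  · subst hy
    simpa only [vecMulVec_zero_right, zero_add, h.map_zero, sub_zero] using hs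
  refine (h.isDyadMap (isDyad_vecMulVec x₀ y₀)).isStandard_or_swap.resolve_right fun hsw => ?_
  obtain ⟨q, hq, hr⟩ := hsw.row x₀ hx
  obtain ⟨p, hp, hc⟩ := hs.column x₀ hx
  have hr₀ : InRow q (φ (vecMulVec x₀ y₀)) := by
    have := hr (-y₀)
    rw [← vecMulVec_add, add_neg_cancel, vecMulVec_zero_right, h.map_zero, zero_sub] at this
    obtain ⟨u, hu⟩ := this
    exact ⟨-u, by rw [neg_vecMulVec, ← hu, neg_neg]⟩
  refine h.isDyadMap_zero.not_column_and_row hx hx hp hq hc fun y => ?_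
  obtain ⟨u, hu⟩ := hr₀
  obtain ⟨w, hw⟩ := hr (y - y₀)
  rw [← vecMulVec_add, add_sub_cancel, sub_eq_iff_eq_add, hu, ← add_vecMulVec] at hw
  exact ⟨_, hw⟩

theorem exists_row (h : IsDyadHom φ)
    (hs : IsStandard fun (x : ι → D) (y : κ → D) => φ (vecMulVec x y))
    (hsurj : ∀ ρ : D →+* E, Function.Surjective ρ)
    (hD : ∃ g h : D, g ≠ 0 ∧ g ≠ 1 ∧ h ≠ 0 ∧ h ≠ 1 ∧ g ≠ h) {x : ι → D} (hx : x ≠ 0) :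
    ∃ (p : ι' → E) (f : (κ → D) → κ' → E) (σ : D →+* E), p ≠ 0 ∧ IsLineation D E f ∧
      (∃ y z, LinearIndependent E ![f y, f z]) ∧ (∀ y z, f (y + z) = f y + f z) ∧
      (∀ (t : D) y, f (t • y) = σ t • f y) ∧ ∀ y, φ (vecMulVec x y) = vecMulVec p (f y) := by
  obtain ⟨p, hp, hc⟩ := hs.column x hx
  choose f hf using hc
  have hdm := h.isDyadMap_zero
  have hline : IsLineation D E f := by
    refine ⟨?_, ?_, ?_⟩
    · intro y z hyz
      by_contra hne
      refine h.ne (vecMulVec x y) (vecMulVec x z) ?_ ?_ ?_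
      · exact fun h' => hne (vecMulVec_right_injective hx h')
      · rw [← vecMulVec_sub]
        exact isDyad_vecMulVec _ _
      · rw [hf, hf, hyz]
    · apply vecMulVec_right_injective hp
      rw [← hf, vecMulVec_zero_right, vecMulVec_zero_right, h.map_zero]
    · intro y v
      by_cases hv : v = 0
      · exact ⟨0, fun t => ⟨0, by rw [hv, smul_zero, smul_zero, add_zero, add_zero]⟩⟩
      obtain ⟨q, hq, hr⟩ := (h.isStandard_of_isStandard_zero hs hx y).row v hv
      refine ⟨q, fun t => ?_⟩
      obtain ⟨u, hu⟩ := hr (op t • x)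
      rw [← vecMulVec_smul_eq_op_smul, ← vecMulVec_add, hf, hf, ← vecMulVec_sub] at hu
      obtain ⟨c, hc⟩ := exists_smul_of_vecMulVec_eq hp hu
      exact ⟨c, by rw [← hc, add_sub_cancel]⟩
  have hpair : ∃ y z, LinearIndependent E ![f y, f z] := by
    by_contra! hcon
    obtain ⟨y, hy⟩ := exists_ne (0 : κ → D)
    have hy' := hline.ne_zero hy
    refine hdm.not_column_and_row hx hx hp hy' (fun z => ⟨_, hf z⟩) fun z => ?_
    by_cases hz : z = 0
    · rw [hf, hz, hline.map_zero, vecMulVec_zero_right]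
      exact inRow_zero _
    obtain ⟨k, -, hk⟩ := exists_smul_of_not_pair hy' (hline.ne_zero hz) (hcon y z)
    rw [hf, hk, vecMulVec_smul_eq_op_smul]
    exact ⟨_, rfl⟩
  obtain ⟨σ, hadd, hsmul⟩ := hline.exists_semilinear hsurj hD hpair
  exact ⟨p, f, σ, hp, hline, hpair, hadd, hsmul, hf⟩

/-- A standard homomorphism acts on dyads by a semilinear map in the second argument. -/
theorem exists_row_semilinear (h : IsDyadHom φ)
    (hs : IsStandard fun (x : ι → D) (y : κ → D) => φ (vecMulVec x y))
    (hsurj : ∀ ρ : D →+* E, Function.Surjective ρ)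
    (hD : ∃ g h : D, g ≠ 0 ∧ g ≠ 1 ∧ h ≠ 0 ∧ h ≠ 1 ∧ g ≠ h) :
    ∃ (g : (ι → D) → ι' → E) (f : (κ → D) → κ' → E) (σ : D →+* E), (∀ x, x ≠ 0 → g x ≠ 0) ∧
      (∀ y, y ≠ 0 → f y ≠ 0) ∧ (∀ y z, f (y + z) = f y + f z) ∧
      (∀ (t : D) y, f (t • y) = σ t • f y) ∧
      ∀ x y, φ (vecMulVec x y) = vecMulVec (g x) (f y) := by
  obtain ⟨x₀, hx₀⟩ := exists_ne (0 : ι → D)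
  obtain ⟨p₀, f, σ, hp₀, hline, hpair, hadd, hsmul, hf⟩ := h.exists_row hs hsurj hD hx₀
  have hdm := h.isDyadMap_zero
  have hg : ∀ x, ∃ u : ι' → E, (x ≠ 0 → u ≠ 0) ∧ ∀ y, φ (vecMulVec x y) = vecMulVec u (f y) := by
    intro x
    by_cases hx : x = 0
    · exact ⟨0, fun h => absurd hx h, fun y => by
        rw [hx, zero_vecMulVec, zero_vecMulVec, h.map_zero]⟩
    obtain ⟨p, f', -, hp, -, -, hadd', -, hf'⟩ := h.exists_row hs hsurj hD hx
    obtain ⟨c, hc⟩ : ∃ c : E, ∀ y, f' y = c • f y := by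
      refine exists_smul_eq_of_forall hadd hadd' (fun y hy => hline.ne_zero hy) hpair fun y => ?_
      by_cases hy : y = 0
      · have f0 : f' 0 = 0 := by simpa using hadd' 0 0
        exact ⟨0, by rw [hy, f0, zero_smul]⟩
      obtain ⟨q, hq, hr⟩ := hs.row y hy
      have hne := hdm.ne_zero x₀ y hx₀ hy
      obtain ⟨u, hu⟩ := InRow.trans hne ⟨p₀, hf y⟩ (hr x₀) (hr x)
      exact exists_smul_of_vecMulVec_eq hp ((hf' y).symm.trans hu)
    have hu : ∀ y, φ (vecMulVec x y) = vecMulVec (op c • p) (f y) := fun y => by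
      rw [hf', hc, vecMulVec_smul_eq_op_smul]
    refine ⟨op c • p, fun _ => ?_, hu⟩
    obtain ⟨y, hy⟩ := exists_ne (0 : κ → D)
    exact left_ne_zero_of_vecMulVec (hu y ▸ hdm.ne_zero x y hx hy)
  choose g hg0 hg using hg
  exact ⟨g, f, σ, hg0, fun y hy => hline.ne_zero hy, hadd, hsmul, hg⟩

end IsDyadHom

end DyadHom

section OpTranspose

open MulOpposite

variable {D E ι κ ι' κ' : Type*} [DivisionRing D] [DivisionRing E]

/-- The transpose of a matrix, with entries in the opposite ring. -/
def opTranspose (A : Matrix ι κ D) : Matrix κ ι Dᵐᵒᵖ := Aᵀ.map op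

/-- The inverse of `opTranspose`. -/
def unopTranspose (A : Matrix κ ι Dᵐᵒᵖ) : Matrix ι κ D := Aᵀ.map unop

theorem opTranspose_zero : opTranspose (0 : Matrix ι κ D) = 0 := rfl

theorem unopTranspose_zero : unopTranspose (0 : Matrix κ ι Dᵐᵒᵖ) = 0 := rfl

theorem opTranspose_sub (A B : Matrix ι κ D) :
    opTranspose (A - B) = opTranspose A - opTranspose B := rfl

theorem unopTranspose_sub (A B : Matrix κ ι Dᵐᵒᵖ) :
    unopTranspose (A - B) = unopTranspose A - unopTranspose B := rfl

theorem isDyad_opTranspose {A : Matrix ι κ D} : IsDyad (opTranspose A) ↔ IsDyad A := by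
  constructor
  · rintro ⟨x, y, h⟩
    exact ⟨unop ∘ y, unop ∘ x, congrArg unopTranspose h⟩
  · rintro ⟨x, y, rfl⟩
    exact isDyad_vecMulVec _ _

theorem isDyad_unopTranspose {A : Matrix κ ι Dᵐᵒᵖ} : IsDyad (unopTranspose A) ↔ IsDyad A :=
  (isDyad_opTranspose (A := unopTranspose A)).symm

theorem inColumn_opTranspose {p : κ → Dᵐᵒᵖ} {A : Matrix ι κ D} :
    InColumn p (opTranspose A) ↔ InRow (unop ∘ p) A := by
  constructor
  · rintro ⟨v, h⟩
    exact ⟨unop ∘ v, congrArg unopTranspose h⟩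
  · rintro ⟨v, rfl⟩
    exact ⟨op ∘ v, rfl⟩

theorem inRow_opTranspose {q : ι → Dᵐᵒᵖ} {A : Matrix ι κ D} :
    InRow q (opTranspose A) ↔ InColumn (unop ∘ q) A := by
  constructor
  · rintro ⟨v, h⟩
    exact ⟨unop ∘ v, congrArg unopTranspose h⟩
  · rintro ⟨v, rfl⟩
    exact ⟨op ∘ v, rfl⟩

theorem unop_comp_ne_zero {p : ι → Dᵐᵒᵖ} (hp : p ≠ 0) : unop ∘ p ≠ 0 := fun h =>
  hp (funext fun i => unop_injective (congrFun h i))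

theorem op_comp_ne_zero {p : ι → D} (hp : p ≠ 0) : op ∘ p ≠ 0 := fun h =>
  hp (funext fun i => op_injective (congrFun h i))

namespace IsDyadHom

variable {φ : Matrix ι κ D → Matrix ι' κ' E}

theorem opTranspose_comp (h : IsDyadHom φ) : IsDyadHom fun X => opTranspose (φ X) where
  map_zero := by rw [h.map_zero, opTranspose_zero]
  ne X Y hXY hd h' := h.ne X Y hXY hd (congrArg unopTranspose h')
  isDyad X Y hd := by
    rw [← opTranspose_sub, isDyad_opTranspose]
    exact h.isDyad X Y hd
  nondeg A hA p q hp hq := by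
    obtain ⟨X, hX, h1, h2⟩ := h.nondeg A hA _ _ (unop_comp_ne_zero hq) (unop_comp_ne_zero hp)
    refine ⟨X, hX, ?_⟩
    rw [← opTranspose_sub, inColumn_opTranspose, inRow_opTranspose]
    exact ⟨h2, h1⟩

theorem comp_unopTranspose (h : IsDyadHom φ) :
    IsDyadHom fun X : Matrix κ ι Dᵐᵒᵖ => φ (unopTranspose X) where
  map_zero := by rw [unopTranspose_zero, h.map_zero]
  ne X Y hXY hd := h.ne _ _ (fun h' => hXY (congrArg opTranspose h'))
    (by rwa [← unopTranspose_sub, isDyad_unopTranspose])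
  isDyad X Y hd := h.isDyad _ _ (by rwa [← unopTranspose_sub, isDyad_unopTranspose])
  nondeg A hA p q hp hq := by
    obtain ⟨X, hX, h'⟩ := h.nondeg (unopTranspose A) (isDyad_unopTranspose.2 hA) p q hp hq
    exact ⟨opTranspose X, isDyad_unopTranspose.1 hX, h'⟩

variable [Nonempty ι] [Nonempty κ] [Nonempty ι'] [Nonempty κ']

/-- A standard homomorphism acts on dyads by semilinear maps in both arguments. -/
theorem exists_bisemilinear (h : IsDyadHom φ)
    (hs : IsStandard fun (x : ι → D) (y : κ → D) => φ (vecMulVec x y))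
    (hsurj : ∀ ρ : D →+* E, Function.Surjective ρ)
    (hD : ∃ g h : D, g ≠ 0 ∧ g ≠ 1 ∧ h ≠ 0 ∧ h ≠ 1 ∧ g ≠ h) :
    ∃ (g : (ι → D) → ι' → E) (f : (κ → D) → κ' → E) (σ : D →+* E), (∀ x, x ≠ 0 → g x ≠ 0) ∧
      (∀ y, y ≠ 0 → f y ≠ 0) ∧ (∀ x z, g (x + z) = g x + g z) ∧ (∀ y z, f (y + z) = f y + f z) ∧
      (∀ (t : D) x, g (op t • x) = op (σ t) • g x) ∧ (∀ (t : D) y, f (t • y) = σ t • f y) ∧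
      ∀ x y, φ (vecMulVec x y) = vecMulVec (g x) (f y) := by
  obtain ⟨g, f, σ, hg0, hf0, hfadd, hfsmul, hgf⟩ := h.exists_row_semilinear hs hsurj hD
  have hdual := h.comp_unopTranspose.opTranspose_comp
  have hsurj' : ∀ ρ : Dᵐᵒᵖ →+* Eᵐᵒᵖ, Function.Surjective ρ := by
    intro ρ e
    obtain ⟨d, hd⟩ := hsurj (RingHom.unop ρ) (unop e)
    exact ⟨op d, unop_injective hd⟩
  have hD' : ∃ g h : Dᵐᵒᵖ, g ≠ 0 ∧ g ≠ 1 ∧ h ≠ 0 ∧ h ≠ 1 ∧ g ≠ h := by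
    obtain ⟨g, h, h1, h2, h3, h4, h5⟩ := hD
    exact ⟨op g, op h, by simpa using h1, by simpa using h2, by simpa using h3, by simpa using h4,
      by simpa using h5⟩
  have hs' : IsStandard fun (y : κ → Dᵐᵒᵖ) (x : ι → Dᵐᵒᵖ) =>
      opTranspose (φ (unopTranspose (vecMulVec y x))) := by
    constructor
    · intro y hy
      obtain ⟨q, hq, hr⟩ := hs.row _ (unop_comp_ne_zero hy)
      exact ⟨op ∘ q, op_comp_ne_zero hq, fun x => inColumn_opTranspose.2 (hr (unop ∘ x))⟩
    · intro x hx
      obtain ⟨p, hp, hc⟩ := hs.column _ (unop_comp_ne_zero hx)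
      exact ⟨op ∘ p, op_comp_ne_zero hp, fun y => inRow_opTranspose.2 (hc (unop ∘ y))⟩
  obtain ⟨g', f', -, -, -, hf'add, -, hgf'⟩ := hdual.exists_row_semilinear hs' hsurj' hD'
  have hφ : ∀ x y, φ (vecMulVec x y) = vecMulVec (unop ∘ f' (op ∘ x)) (unop ∘ g' (op ∘ y)) :=
    fun x y => congrArg unopTranspose (hgf' (op ∘ y) (op ∘ x))
  obtain ⟨y, hy⟩ := exists_ne (0 : κ → D)
  refine ⟨g, f, σ, hg0, hf0, fun x z => ?_, hfadd, fun t x => ?_, hfsmul, hgf⟩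
  · apply vecMulVec_left_injective (hf0 y hy)
    have hadd : (unop ∘ f' (op ∘ (x + z)) : ι' → E) = unop ∘ f' (op ∘ x) + unop ∘ f' (op ∘ z) := by
      have : (op ∘ (x + z) : ι → Dᵐᵒᵖ) = op ∘ x + op ∘ z := rfl
      rw [this, hf'add]
      rfl
    dsimp only
    rw [add_vecMulVec, ← hgf, ← hgf, ← hgf, hφ, hφ, hφ, hadd, add_vecMulVec]
  · apply vecMulVec_left_injective (hf0 y hy)
    dsimp only
    rw [← hgf, ← vecMulVec_smul_eq_op_smul, hgf, hfsmul, vecMulVec_smul_eq_op_smul]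

end IsDyadHom

end OpTranspose

section RankInduction

open MulOpposite

variable {D E ι κ ι' κ' : Type*} [DivisionRing D] [DivisionRing E]

theorem vecMulVec_add_add_vecMulVec (a b : ι → E) (c d : κ → E) :
    vecMulVec a (c + d) + vecMulVec b d = vecMulVec a c + vecMulVec (a + b) d := by
  rw [vecMulVec_add, add_vecMulVec, add_assoc]

theorem not_mem_line_of_pair {W : Type*} [AddCommGroup W] [Module E W] {a b c : W}
    (h : LinearIndependent E ![a, b]) {s t : E} (ha : a = s • c) (hb : a + b = t • c) : False := by
  have ha0 : a ≠ 0 := h.ne_zero 0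
  have hs : s ≠ 0 := by
    rintro rfl
    exact ha0 (by rw [ha, zero_smul])
  refine (LinearIndependent.pair_iff' ha0).1 h (t * s⁻¹ - 1) ?_
  have hc : c = s⁻¹ • a := by rw [ha, smul_smul, inv_mul_cancel₀ hs, one_smul]
  rw [sub_smul, one_smul, mul_smul, ← hc, ← hb, add_sub_cancel_left]

theorem exists_op_smul_of_add_eq {b₁ b₂ u : ι → E} {v₁ v₂ a : κ → E}
    (hv : LinearIndependent E ![v₁, v₂])
    (h : vecMulVec b₁ v₁ + vecMulVec b₂ v₂ = vecMulVec u a) :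
    ∃ s t : E, b₁ = op s • u ∧ b₂ = op t • u := by
  have hi : ∀ i, b₁ i • v₁ + b₂ i • v₂ = u i • a := fun i => funext fun j =>
    congrFun (congrFun h i) j
  have hv' := LinearIndependent.pair_iff.1 hv
  by_cases hu : u = 0
  · subst hu
    refine ⟨0, 0, ?_, ?_⟩ <;> ext i
    · simpa using (hv' _ _ (by simpa using hi i)).1
    · simpa using (hv' _ _ (by simpa using hi i)).2
  obtain ⟨i, hui⟩ := Function.ne_iff.1 hu
  have hui' : u i ≠ 0 := hui
  obtain ⟨s, t, ha⟩ : ∃ s t : E, a = s • v₁ + t • v₂ := by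
    refine ⟨(u i)⁻¹ * b₁ i, (u i)⁻¹ * b₂ i, ?_⟩
    rw [mul_smul, mul_smul, ← smul_add, hi, smul_smul, inv_mul_cancel₀ hui', one_smul]
  have hk : ∀ k, b₁ k = u k * s ∧ b₂ k = u k * t := by
    intro k
    have := hi k
    rw [ha, smul_add, smul_smul, smul_smul, ← sub_eq_zero, add_sub_add_comm, ← sub_smul,
      ← sub_smul] at this
    obtain ⟨h1, h2⟩ := hv' _ _ this
    exact ⟨sub_eq_zero.1 h1, sub_eq_zero.1 h2⟩
  exact ⟨s, t, funext fun k => (hk k).1, funext fun k => (hk k).2⟩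

theorem eq_zero_or_eq_neg_of_isDyad {u₁ u₂ : ι → E} {v₁ v₂ : κ → E} {A : Matrix ι κ E}
    (hu : LinearIndependent Eᵐᵒᵖ ![u₁, u₂]) (hv : LinearIndependent E ![v₁, v₂])
    (h₁ : IsDyad (A + vecMulVec u₁ v₁)) (h₁₂ : IsDyad (A + vecMulVec u₁ (v₁ + v₂)))
    (h₂ : IsDyad (A + vecMulVec u₂ v₂)) (h₂₁ : IsDyad (A + vecMulVec u₂ (v₁ + v₂))) :
    A = 0 ∨ A = -(vecMulVec u₁ v₁ + vecMulVec u₂ v₂) := by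
  have hu₁ : u₁ ≠ 0 := hu.ne_zero 0
  have hu₂ : u₂ ≠ 0 := hu.ne_zero 1
  have hv₁ : v₁ ≠ 0 := hv.ne_zero 0
  have hv₂ : v₂ ≠ 0 := hv.ne_zero 1
  have hu' := LinearIndependent.pair_iff.1 hu
  have hne₁ : ∀ c : E, u₁ ≠ op c • u₂ := fun c hc => by
    simpa using (hu' 1 (-op c) (by rw [one_smul, neg_smul, hc, add_neg_cancel])).1
  have hne₂ : ∀ c : E, u₂ ≠ op c • u₁ := fun c hc => by
    simpa using (hu' (-op c) 1 (by rw [one_smul, neg_smul, hc, neg_add_cancel])).2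
  rw [vecMulVec_add, ← add_assoc] at h₁₂
  rw [vecMulVec_add, add_comm (vecMulVec u₂ v₁), ← add_assoc] at h₂₁
  obtain ⟨a, ha⟩ | ⟨b, hb⟩ := inColumn_or_inRow_of_add h₁ hu₁ hv₂ h₁₂
  · have ha' : A = vecMulVec u₁ (a - v₁) := by rw [vecMulVec_sub, ← ha, add_sub_cancel_right]
    obtain ⟨a', hb⟩ | ⟨b', hb⟩ := inColumn_or_inRow_of_add h₂ hu₂ hv₁ h₂₁
    · have hb' : A = vecMulVec u₂ (a' - v₂) := by rw [vecMulVec_sub, ← hb, add_sub_cancel_right]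
      left
      by_contra hA
      rw [ha'] at hA
      obtain ⟨c, hc⟩ := exists_op_smul_of_vecMulVec_eq (right_ne_zero_of_vecMulVec hA)
        (ha'.symm.trans hb')
      exact (hne₁ c hc).elim
    · exfalso
      obtain ⟨s, t, -, ht⟩ := exists_op_smul_of_add_eq (b₁ := b') (b₂ := -u₂) (u := u₁)
        (a := a - v₁) hv (by rw [← hb, ← ha', neg_vecMulVec, add_neg_cancel_right])
      exact hne₂ (-t) (by rw [op_neg, neg_smul, ← ht, neg_neg])
  · obtain ⟨a', ha⟩ | ⟨b', hb'⟩ := inColumn_or_inRow_of_add h₂ hu₂ hv₁ h₂₁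
    · have ha' : A = vecMulVec u₂ (a' - v₂) := by rw [vecMulVec_sub, ← ha, add_sub_cancel_right]
      exfalso
      obtain ⟨s, t, hs, -⟩ := exists_op_smul_of_add_eq (b₁ := -u₁) (b₂ := b) (u := u₂)
        (a := a' - v₂) hv (by rw [← hb, ← ha', neg_vecMulVec, add_comm, add_neg_cancel_right])
      exact hne₁ (-s) (by rw [op_neg, neg_smul, ← hs, neg_neg])
    · right
      obtain ⟨s, t, -, ht⟩ := exists_op_smul_of_add_eq (b₁ := b' + u₁) (b₂ := -(b + u₂)) (u := 0)
        (a := 0) hv (by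
          rw [neg_vecMulVec, add_vecMulVec, add_vecMulVec, ← hb, ← hb', zero_vecMulVec]
          abel)
      rw [smul_zero, neg_eq_zero] at ht
      rw [eq_neg_of_add_eq_zero_left ht, neg_vecMulVec] at hb
      rw [neg_add, ← hb, add_comm A, neg_add_cancel_left]

/-- Sums of `k` dyads. -/
def IsDyadSum : ℕ → Matrix ι κ D → Prop
  | 0, X => X = 0
  | k + 1, X => ∃ Z x y, IsDyadSum k Z ∧ X = Z + vecMulVec x y

theorem exists_isDyadSum [Fintype ι] (X : Matrix ι κ D) : ∃ k, IsDyadSum (k + 1) X := by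
  classical
  suffices h : ∀ s : Finset ι, ∃ k, IsDyadSum (k + 1)
      (∑ i ∈ s, vecMulVec (Pi.single i 1 : ι → D) (X i)) by
    obtain ⟨k, hk⟩ := h Finset.univ
    refine ⟨k, ?_⟩
    convert hk
    ext i j
    rw [Matrix.sum_apply, Finset.sum_eq_single i]
    · simp [vecMulVec_apply]
    · intro l _ hl
      simp [vecMulVec_apply, Pi.single_eq_of_ne hl.symm]
    · simp
  intro s
  induction s using Finset.induction_on with
  | empty => exact ⟨0, 0, 0, 0, rfl, by simp⟩
  | insert i s hi ih =>
    obtain ⟨k, hk⟩ := ih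
    exact ⟨k + 1, _, _, _, hk, by rw [Finset.sum_insert hi, add_comm]⟩

variable {φ : Matrix ι κ D → Matrix ι' κ' E} {Ψ : Matrix ι κ D →+ Matrix ι' κ' E}
  {g : (ι → D) → ι' → E} {f : (κ → D) → κ' → E}

theorem IsDyadHom.pair_of_sum (h : IsDyadHom φ) (hfadd : ∀ y z, f (y + z) = f y + f z)
    (hg : ∀ x z, LinearIndependent Dᵐᵒᵖ ![x, z] → LinearIndependent Eᵐᵒᵖ ![g x, g z])
    (hf : ∀ y z, LinearIndependent D ![y, z] → LinearIndependent E ![f y, f z])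
    (hΨ : ∀ x y, Ψ (vecMulVec x y) = vecMulVec (g x) (f y)) {k : ℕ}
    (hk : ∀ X, IsDyadSum (k + 1) X → φ X = Ψ X) {X Z : Matrix ι κ D} {x₁ x₂ : ι → D}
    {y₁ y₂ : κ → D} (hZ : IsDyadSum k Z) (hX : X = Z + vecMulVec x₁ y₁ + vecMulVec x₂ y₂)
    (hX' : ¬ IsDyadSum (k + 1) X) :
    LinearIndependent Dᵐᵒᵖ ![x₁, x₂] ∧ LinearIndependent D ![y₁, y₂] ∧
      (φ X = Ψ X ∨ φ X - Ψ X = -(vecMulVec (g x₁) (f y₁) + vecMulVec (g x₂) (f y₂))) := by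
  have hmem : ∀ x y, IsDyadSum (k + 1) (Z + vecMulVec x y) := fun x y => ⟨Z, x, y, hZ, rfl⟩
  have hx : LinearIndependent Dᵐᵒᵖ ![x₁, x₂] := by
    have hx₁ : x₁ ≠ 0 := by
      rintro rfl
      apply hX'
      rw [hX, zero_vecMulVec, add_zero]
      exact hmem _ _
    rw [LinearIndependent.pair_iff' hx₁]
    rintro c rfl
    apply hX'
    rw [hX, ← op_unop c, ← vecMulVec_smul_eq_op_smul, add_assoc, ← vecMulVec_add]
    exact hmem _ _
  have hy : LinearIndependent D ![y₁, y₂] := by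
    have hy₁ : y₁ ≠ 0 := by
      rintro rfl
      apply hX'
      rw [hX, vecMulVec_zero_right, add_zero]
      exact hmem _ _
    rw [LinearIndependent.pair_iff' hy₁]
    rintro c rfl
    apply hX'
    rw [hX, vecMulVec_smul_eq_op_smul, add_assoc, ← add_vecMulVec]
    exact hmem _ _
  have hdyad : ∀ x y, IsDyadSum (k + 1) (X - vecMulVec x y) →
      IsDyad (φ X - Ψ X + vecMulVec (g x) (f y)) := by
    intro x y hxy
    have := h.isDyad X (X - vecMulVec x y) (by rw [sub_sub_cancel]; exact isDyad_vecMulVec x y)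
    rwa [hk _ hxy, map_sub, hΨ, sub_sub_eq_add_sub, add_sub_right_comm] at this
  refine ⟨hx, hy, ?_⟩
  rw [← sub_eq_zero]
  refine eq_zero_or_eq_neg_of_isDyad (hg _ _ hx) (hf _ _ hy) (hdyad _ _ ?_) ?_ (hdyad _ _ ?_) ?_
  · rw [hX, add_right_comm, add_sub_cancel_right]
    exact hmem _ _
  · rw [← hfadd]
    refine hdyad _ _ ?_
    have : X - vecMulVec x₁ (y₁ + y₂) = Z + vecMulVec (x₂ - x₁) y₂ := by
      rw [hX, vecMulVec_add, sub_vecMulVec]; abel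
    rw [this]
    exact hmem _ _
  · rw [hX, add_sub_cancel_right]
    exact hmem _ _
  · rw [← hfadd]
    refine hdyad _ _ ?_
    have : X - vecMulVec x₂ (y₁ + y₂) = Z + vecMulVec (x₁ - x₂) y₁ := by
      rw [hX, vecMulVec_add, sub_vecMulVec]; abel
    rw [this]
    exact hmem _ _

/-- A homomorphism agreeing on dyads with a suitable additive map agrees with it everywhere. -/
theorem IsDyadHom.eq_of_forall_vecMulVec [Fintype ι] (h : IsDyadHom φ)
    (hfadd : ∀ y z, f (y + z) = f y + f z)
    (hg : ∀ x z, LinearIndependent Dᵐᵒᵖ ![x, z] → LinearIndependent Eᵐᵒᵖ ![g x, g z])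
    (hf : ∀ y z, LinearIndependent D ![y, z] → LinearIndependent E ![f y, f z])
    (hΨ : ∀ x y, Ψ (vecMulVec x y) = vecMulVec (g x) (f y))
    (hφ : ∀ x y, φ (vecMulVec x y) = vecMulVec (g x) (f y)) (X : Matrix ι κ D) : φ X = Ψ X := by
  suffices hall : ∀ k, ∀ X, IsDyadSum (k + 1) X → φ X = Ψ X by
    obtain ⟨k, hk⟩ := exists_isDyadSum X
    exact hall k X hk
  clear X
  intro k
  induction k with
  | zero =>
    rintro X ⟨Z, x, y, hZ, rfl⟩
    have hZ0 : Z = 0 := hZ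
    rw [hZ0, zero_add, hφ, hΨ]
  | succ k ih =>
    intro X hX
    by_cases hXk : IsDyadSum (k + 1) X
    · exact ih X hXk
    obtain ⟨W, x₂, y₂, ⟨Z, x₁, y₁, hZ, rfl⟩, hX⟩ := hX
    obtain ⟨hx, hy, hΔ⟩ := h.pair_of_sum hfadd hg hf hΨ ih hZ hX hXk
    refine hΔ.resolve_right fun hΔ => ?_
    cases k with
    | zero =>
      have hZ0 : Z = 0 := hZ
      have hX0 : φ X = 0 := by
        have hX2 : X = vecMulVec x₁ y₁ + vecMulVec x₂ y₂ := by rw [hX, hZ0, zero_add]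
        have hΨX : Ψ X = vecMulVec (g x₁) (f y₁) + vecMulVec (g x₂) (f y₂) := by
          rw [hX2, map_add, hΨ, hΨ]
        rwa [hΨX, sub_eq_neg_self] at hΔ
      let X' := Z + vecMulVec x₁ (y₁ + y₂) + vecMulVec x₂ y₂
      have hX' : ¬ IsDyadSum (0 + 1) X' := by
        rintro ⟨Z', a, b, hZ', he⟩
        have hZ'0 : Z' = 0 := hZ'
        have he' : vecMulVec x₁ y₁ + vecMulVec (x₁ + x₂) y₂ = vecMulVec a b := by
          rw [← vecMulVec_add_add_vecMulVec]
          simpa only [X', hZ0, hZ'0, zero_add] using he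
        obtain ⟨s, t, hs, ht⟩ := exists_op_smul_of_add_eq hy he'
        exact not_mem_line_of_pair hx hs ht
      have hsub : X' - X = vecMulVec x₁ y₂ := by
        simp only [X', hX, vecMulVec_add]; abel
      have hne : φ X' ≠ 0 := by
        rw [← hX0]
        refine h.ne _ _ ?_ ?_
        · rw [← sub_ne_zero, hsub]
          exact vecMulVec_ne_zero_of_ne (hx.ne_zero 0) (hy.ne_zero 1)
        · rw [hsub]
          exact isDyad_vecMulVec _ _
      have hΨX' : Ψ X' = vecMulVec (g x₁) (f (y₁ + y₂)) + vecMulVec (g x₂) (f y₂) := by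
        simp only [X']
        rw [map_add, map_add, hZ0, _root_.map_zero, zero_add, hΨ, hΨ]
      obtain ⟨-, -, he | he⟩ := h.pair_of_sum hfadd hg hf hΨ ih hZ (X := X') rfl hX'
      · obtain ⟨a, b, hab⟩ := h.isDyad X' X (by rw [hsub]; exact isDyad_vecMulVec _ _)
        rw [hX0, sub_zero, he, hΨX', hfadd, vecMulVec_add_add_vecMulVec] at hab
        obtain ⟨s, t, hs, ht⟩ := exists_op_smul_of_add_eq (hf _ _ hy) hab
        exact not_mem_line_of_pair (hg _ _ hx) hs ht
      · rw [← hΨX', sub_eq_neg_self] at he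
        exact hne he
    | succ k =>
      obtain ⟨Y, x₃, y₃, hY, rfl⟩ := hZ
      obtain ⟨-, -, he⟩ := h.pair_of_sum hfadd hg hf hΨ ih (X := X)
        (Z := Y + vecMulVec x₂ y₂) (x₁ := x₁) (x₂ := x₃) (y₁ := y₁) (y₂ := y₃) ⟨Y, _, _, hY, rfl⟩
        (by rw [hX]; abel) hXk
      obtain ⟨hx', hy', -⟩ := h.pair_of_sum hfadd hg hf hΨ ih (X := X)
        (Z := Y + vecMulVec x₁ y₁) (x₁ := x₃) (x₂ := x₂) (y₁ := y₃) (y₂ := y₂) ⟨Y, _, _, hY, rfl⟩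
        (by rw [hX]; abel) hXk
      have hv := hf _ _ hy'
      have hu₂ : g x₂ ≠ 0 := (hg _ _ hx).ne_zero 1
      obtain he | he := he
      · rw [he, sub_self, eq_comm, neg_eq_zero] at hΔ
        obtain ⟨s, t, hs, ht⟩ := exists_op_smul_of_add_eq (u := 0) (a := 0) (hf _ _ hy)
          (by rw [hΔ, zero_vecMulVec])
        exact hu₂ (by rw [ht, smul_zero])
      · rw [he, neg_inj, add_right_inj] at hΔ
        obtain ⟨c, hc⟩ := exists_smul_of_vecMulVec_eq hu₂ hΔ.symm
        exact (LinearIndependent.pair_iff' (hv.ne_zero 0)).1 hv c hc.symm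

end RankInduction

section Extension

open MulOpposite

variable {D E : Type*} [DivisionRing D] [DivisionRing E]

theorem exists_basis_extending {k n : ℕ} {v : Fin k → Fin n → E} (hv : LinearIndependent E v) :
    ∃ h : k ≤ n, ∃ b : Module.Basis (Fin n) E (Fin n → E), ∀ i, b (Fin.castLE h i) = v i := by
  have hkn : k ≤ n := by simpa using hv.fintype_card_le_finrank
  let b := Module.Basis.sumExtend hv
  have : Finite (Fin k ⊕ Module.Basis.sumExtendIndex hv) := Module.Finite.finite_basis b
  have : Finite (Module.Basis.sumExtendIndex hv) :=
    Finite.of_injective (Sum.inr : _ → Fin k ⊕ _) Sum.inr_injective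
  have := Fintype.ofFinite (Module.Basis.sumExtendIndex hv)
  have hcard : Fintype.card (Module.Basis.sumExtendIndex hv) = n - k := by
    have h := Module.finrank_eq_card_basis b
    rw [Module.finrank_fin_fun, Fintype.card_sum, Fintype.card_fin] at h
    omega
  let e : Fin k ⊕ Module.Basis.sumExtendIndex hv ≃ Fin n :=
    ((Equiv.refl _).sumCongr (Fintype.equivFinOfCardEq hcard)).trans
      (finSumFinEquiv.trans (finCongr (by omega)))
  refine ⟨hkn, b.reindex e, fun i => ?_⟩
  have he : e.symm (Fin.castLE hkn i) = Sum.inl i := by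
    rw [Equiv.symm_apply_eq]
    ext
    simp [e]
  rw [Module.Basis.reindex_apply, he]
  simp [b, Module.Basis.sumExtend, Equiv.Set.sumDiffSubset]
  rfl

/-- A linearly independent family of rows extends to an invertible matrix. -/
theorem exists_isUnit_rows {k n : ℕ} {v : Fin k → Fin n → E} (hv : LinearIndependent E v) :
    ∃ h : k ≤ n, ∃ Q : Matrix (Fin n) (Fin n) E, IsUnit Q ∧ ∀ i, Q (Fin.castLE h i) = v i := by
  obtain ⟨h, b, hb⟩ := exists_basis_extending hv
  let L := (Pi.basisFun E (Fin n)).equiv b (Equiv.refl _)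
  refine ⟨h, LinearMap.toMatrixRight' L.toLinearMap, ?_, fun i => ?_⟩
  · refine ⟨⟨LinearMap.toMatrixRight' L.toLinearMap, LinearMap.toMatrixRight' L.symm.toLinearMap,
      ?_, ?_⟩, rfl⟩ <;> simp [← LinearMap.toMatrixRight'_comp]
  · rw [← hb]
    have hL : L (Pi.single (Fin.castLE h i) 1) = b (Fin.castLE h i) := by
      rw [← Pi.basisFun_apply, Module.Basis.equiv_apply, Equiv.refl_apply]
    rw [← hL]
    rfl

theorem unopTranspose_mul {ι κ μ : Type*} [Fintype κ] (A : Matrix ι κ Dᵐᵒᵖ)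
    (B : Matrix κ μ Dᵐᵒᵖ) :
    unopTranspose (A * B) = unopTranspose B * unopTranspose A := by
  ext i j
  simp [unopTranspose, Matrix.mul_apply]

theorem isUnit_unopTranspose {n : ℕ} {A : Matrix (Fin n) (Fin n) Dᵐᵒᵖ} (hA : IsUnit A) :
    IsUnit (unopTranspose A) := by
  have h1 : unopTranspose (1 : Matrix (Fin n) (Fin n) Dᵐᵒᵖ) = 1 := by
    rw [unopTranspose, transpose_one, Matrix.map_one _ unop_zero unop_one]
  obtain ⟨⟨A, B, hAB, hBA⟩, rfl⟩ := hA
  exact ⟨⟨unopTranspose A, unopTranspose B, by rw [← unopTranspose_mul, hBA, h1],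
    by rw [← unopTranspose_mul, hAB, h1]⟩, rfl⟩

theorem linearIndependent_op_comp {η ι : Type*} {u : η → ι → E} (hu : LinearIndependent Eᵐᵒᵖ u) :
    LinearIndependent Eᵐᵒᵖ fun i => (op ∘ u i : ι → Eᵐᵒᵖ) :=
  hu.map_of_surjective_injective id
    ({ toFun := fun x => op ∘ x, map_zero' := rfl, map_add' := fun _ _ => rfl } :
      (ι → E) →+ (ι → Eᵐᵒᵖ)) Function.surjective_id
    (fun x hx => funext fun i => op_injective (congrFun hx i))
    (fun r x => funext fun i => unop_injective (by simp))

/-- A linearly independent family of columns extends to an invertible matrix. -/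
theorem exists_isUnit_columns {k n : ℕ} {u : Fin k → Fin n → E} (hu : LinearIndependent Eᵐᵒᵖ u) :
    ∃ h : k ≤ n, ∃ P : Matrix (Fin n) (Fin n) E, IsUnit P ∧
      ∀ i j, P i (Fin.castLE h j) = u j i := by
  obtain ⟨h, Q, hQ, hQu⟩ := exists_isUnit_rows (linearIndependent_op_comp hu)
  exact ⟨h, unopTranspose Q, isUnit_unopTranspose hQ,
    fun i j => congrArg unop (congrFun (hQu j) i)⟩

theorem linearIndependent_comp_row {η κ κ' : Type*} {f : (κ → D) → κ' → E} {σ : D →+* E}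
    (hσ : Function.Surjective σ) (hadd : ∀ y z, f (y + z) = f y + f z)
    (hsmul : ∀ t y, f (t • y) = σ t • f y) (h0 : ∀ y, y ≠ 0 → f y ≠ 0) {v : η → κ → D}
    (hv : LinearIndependent D v) : LinearIndependent E fun i => f (v i) :=
  hv.map_of_surjective_injective σ (AddMonoidHom.mk' f hadd) hσ
    (fun y hy => by_contra fun h => h0 y h hy) hsmul

theorem linearIndependent_comp_column {η ι ι' : Type*} {g : (ι → D) → ι' → E} {σ : D →+* E}
    (hσ : Function.Surjective σ) (hadd : ∀ y z, g (y + z) = g y + g z)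
    (hsmul : ∀ (t : D) x, g (op t • x) = op (σ t) • g x) (h0 : ∀ x, x ≠ 0 → g x ≠ 0)
    {u : η → ι → D} (hu : LinearIndependent Dᵐᵒᵖ u) : LinearIndependent Eᵐᵒᵖ fun i => g (u i) :=
  hu.map_of_surjective_injective (fun t => op (σ (unop t))) (AddMonoidHom.mk' g hadd)
    (op_surjective.comp (hσ.comp unop_surjective))
    (fun x hx => by_contra fun h => h0 x h hx) fun t x => hsmul (unop t) x

end Extension

section StandardForm

open MulOpposite

variable {D E : Type} [DivisionRing D] [DivisionRing E]

theorem mul_embedM_mul {m n m' n' : ℕ} (hm : m ≤ m') (hn : n ≤ n')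
    (P : Matrix (Fin m') (Fin m') E) (Y : Matrix (Fin m) (Fin n) E)
    (Q : Matrix (Fin n') (Fin n') E) :
    P * (embedM Y : Matrix (Fin m') (Fin n') E) * Q =
      P.submatrix id (Fin.castLE hm) * Y * Q.submatrix (Fin.castLE hn) id := by
  have hP : ∀ a (j' : Fin n'), (P * (embedM Y : Matrix (Fin m') (Fin n') E)) a j' =
      if h : j'.val < n then (P.submatrix id (Fin.castLE hm) * Y) a ⟨j', h⟩ else 0 := by
    intro a j'
    split_ifs with h
    · rw [Matrix.mul_apply, Matrix.mul_apply]
      symm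
      refine Fintype.sum_of_injective (Fin.castLE hm) (Fin.castLE_injective hm) _ _ ?_ ?_
      · intro i hi
        have : ¬ i.val < m := fun h' => hi ⟨⟨i, h'⟩, rfl⟩
        simp [embedM, this]
      · intro i
        simp [embedM, h]
    · rw [Matrix.mul_apply]
      simp [embedM, h]
  ext a b
  rw [Matrix.mul_apply, Matrix.mul_apply]
  symm
  refine Fintype.sum_of_injective (Fin.castLE hn) (Fin.castLE_injective hn) _ _ ?_ ?_
  · intro j hj
    have : ¬ j.val < n := fun h' => hj ⟨⟨j, h'⟩, rfl⟩
    rw [hP, dif_neg this, zero_mul]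
  · intro j
    rw [hP, dif_pos (by simp)]
    rfl

variable {ι κ ι' κ' : Type*}

theorem vecMul_of_comp [Fintype κ] [DecidableEq κ] {f : (κ → D) → κ' → E} {σ : D →+* E}
    (hadd : ∀ y z, f (y + z) = f y + f z) (hsmul : ∀ t y, f (t • y) = σ t • f y) (y : κ → D) :
    (σ ∘ y) ᵥ* (Matrix.of fun j => f (Pi.single j 1)) = f y := by
  have hy : f y = ∑ j, σ (y j) • f (Pi.single j 1) := by
    conv_lhs => rw [pi_eq_sum_univ' y]
    rw [← AddMonoidHom.mk'_apply f hadd, map_sum]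
    refine Finset.sum_congr rfl fun j _ => ?_
    rw [AddMonoidHom.mk'_apply, hsmul]
  rw [hy]
  ext j
  simp [vecMul, dotProduct]

theorem mulVec_of_comp [Fintype ι] [DecidableEq ι] {g : (ι → D) → ι' → E} {σ : D →+* E}
    (hadd : ∀ y z, g (y + z) = g y + g z) (hsmul : ∀ (t : D) x, g (op t • x) = op (σ t) • g x)
    (x : ι → D) :
    (Matrix.of fun i' i => g (Pi.single i 1) i') *ᵥ (σ ∘ x) = g x := by
  have hx : g x = ∑ i, op (σ (x i)) • g (Pi.single i 1) := by
    have : x = ∑ i, op (x i) • Pi.single i 1 := by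
      ext k
      simp [Finset.sum_apply, Pi.single_apply]
    conv_lhs => rw [this]
    rw [← AddMonoidHom.mk'_apply g hadd, map_sum]
    exact Finset.sum_congr rfl fun i _ => hsmul _ _
  rw [hx]
  ext j
  simp [mulVec, dotProduct]

theorem linearIndependent_op_single (m : ℕ) :
    LinearIndependent Dᵐᵒᵖ fun i : Fin m => (Pi.single i 1 : Fin m → D) := by
  rw [Fintype.linearIndependent_iff]
  intro c hc i
  simpa [Finset.sum_apply, Pi.single_apply] using congrFun hc i

/-- A standard homomorphism of matrix spaces is of the form `X ↦ P * diag(X^σ, 0) * Q`. -/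
theorem IsDyadHom.exists_eq_mul_embedM_mul {m n m' n' : ℕ} [Nonempty (Fin m)] [Nonempty (Fin n)]
    [Nonempty (Fin m')] [Nonempty (Fin n')]
    {φ : Matrix (Fin m) (Fin n) D → Matrix (Fin m') (Fin n') E} (h : IsDyadHom φ)
    (hs : IsStandard fun x y => φ (vecMulVec x y))
    (hsurj : ∀ ρ : D →+* E, Function.Surjective ρ)
    (hD : ∃ g h : D, g ≠ 0 ∧ g ≠ 1 ∧ h ≠ 0 ∧ h ≠ 1 ∧ g ≠ h) :
    m ≤ m' ∧ n ≤ n' ∧ ∃ (P : Matrix (Fin m') (Fin m') E) (Q : Matrix (Fin n') (Fin n') E),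
      IsUnit P ∧ IsUnit Q ∧ ∃ σ : D →+* E, ∀ X, 
        φ X = P * (embedM (X.map σ) : Matrix (Fin m') (Fin n') E) * Q := by
  obtain ⟨g, f, σ, hg0, hf0, hgadd, hfadd, hgsmul, hfsmul, hφ⟩ := h.exists_bisemilinear hs hsurj hD
  have hσ := hsurj σ
  obtain ⟨hm, P, hP, hPg⟩ := exists_isUnit_columns (linearIndependent_comp_column hσ hgadd hgsmul
    hg0 (linearIndependent_op_single m))
  obtain ⟨hn, Q, hQ, hQf⟩ := exists_isUnit_rows (linearIndependent_comp_row hσ hfadd hfsmul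
    hf0 (v := fun j : Fin n => Pi.single j 1) (Pi.linearIndependent_single_one _ _))
  refine ⟨hm, hn, P, Q, hP, hQ, σ, fun X => ?_⟩
  let Ψ : Matrix (Fin m) (Fin n) D →+ Matrix (Fin m') (Fin n') E :=
    AddMonoidHom.mk' (fun X => P * (embedM (X.map σ) : Matrix (Fin m') (Fin n') E) * Q)
      fun X Y => by
        simp only [mul_embedM_mul hm hn, Matrix.map_add _ (map_add σ), Matrix.mul_add, Matrix.add_mul]
  have hPG : P.submatrix id (Fin.castLE hm) = of fun i' i => g (Pi.single i 1) i' := by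
    ext i j
    exact hPg i j
  have hQF : Q.submatrix (Fin.castLE hn) id = of fun j => f (Pi.single j 1) := by
    ext i j
    exact congrFun (hQf i) j
  refine h.eq_of_forall_vecMulVec (Ψ := Ψ) (g := g) (f := f) hfadd ?_ ?_ ?_ hφ X
  · intro x z hxz
    convert linearIndependent_comp_column hσ hgadd hgsmul hg0 hxz using 1
    ext i
    fin_cases i <;> rfl
  · intro x z hxz
    convert linearIndependent_comp_row hσ hfadd hfsmul hf0 hxz using 1
    ext i
    fin_cases i <;> rfl
  · intro x y
    have hmap : (vecMulVec x y).map σ = vecMulVec (σ ∘ x) (σ ∘ y) := by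
      ext i j
      simp [vecMulVec_apply]
    rw [AddMonoidHom.mk'_apply, mul_embedM_mul hm hn, hPG, hQF, hmap, mul_vecMulVec, vecMulVec_mul,
      mulVec_of_comp hgadd hgsmul, vecMul_of_comp hfadd hfsmul]

end StandardForm

section Rank

open MulOpposite

variable {D : Type} [DivisionRing D]

theorem mrank_le_one_iff_isDyad {m n : ℕ} (A : Matrix (Fin m) (Fin n) D) :
    mrank A ≤ 1 ↔ IsDyad A := by
  constructor
  · intro h
    obtain ⟨y, hy⟩ := ((Submodule.finrank_le_one_iff_isPrincipal _).1 h).principal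
    have hmem : ∀ i, ∃ c : D, c • y = A i := fun i =>
      Submodule.mem_span_singleton.1 (hy ▸ Submodule.subset_span ⟨i, rfl⟩)
    choose c hc using hmem
    exact ⟨c, y, ext fun i j => (congrFun (hc i) j).symm⟩
  · rintro ⟨x, y, rfl⟩
    refine (Submodule.finrank_mono (Submodule.span_le.2 ?_)).trans
      (finrank_span_le_card (R := D) ({y} : Set (Fin n → D)) |>.trans (by simp))
    rintro _ ⟨i, rfl⟩
    exact Submodule.mem_span_singleton.2 ⟨x i, rfl⟩

theorem mrank_eq_zero_iff {m n : ℕ} (A : Matrix (Fin m) (Fin n) D) : mrank A = 0 ↔ A = 0 := by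
  rw [mrank, Submodule.finrank_eq_zero, Submodule.span_eq_bot]
  constructor
  · exact fun h => ext fun i j => congrFun (h _ ⟨i, rfl⟩) j
  · rintro rfl _ ⟨i, rfl⟩
    rfl

theorem mrank_eq_one_iff {m n : ℕ} (A : Matrix (Fin m) (Fin n) D) :
    mrank A = 1 ↔ A ≠ 0 ∧ IsDyad A := by
  rw [← mrank_le_one_iff_isDyad, Ne, ← mrank_eq_zero_iff]
  omega

theorem isTypeOne_setOf_inColumn {m n : ℕ} (B : Matrix (Fin m) (Fin n) D) {p : Fin m → D}
    (hp : p ≠ 0) : IsTypeOne {X | InColumn p (X - B)} := by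
  obtain ⟨h, P, hP, hPp⟩ := exists_isUnit_columns (u := fun _ : Fin 1 => p)
    (LinearIndependent.of_subsingleton 0 hp)
  have h0 : ∀ i : Fin m, i.val = 0 ↔ i = Fin.castLE h 0 := fun i => by simp [Fin.ext_iff]
  have key : ∀ (v : Fin n → D), P * vecMulVec (Pi.single (Fin.castLE h 0) 1) v = vecMulVec p v := by
    intro v
    rw [mul_vecMulVec]
    congr 1
    ext i
    simp [hPp]
  refine ⟨P, B, hP, Set.ext fun X => ⟨?_, ?_⟩⟩
  · rintro ⟨v, hv⟩
    refine ⟨vecMulVec (Pi.single (Fin.castLE h 0) 1) v, fun i j hi => ?_, ?_⟩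
    · rw [Ne, h0] at hi
      simp [vecMulVec_apply, hi]
    · simp only [key, ← hv, sub_add_cancel]
  · rintro ⟨Y, hY, rfl⟩
    refine ⟨Y (Fin.castLE h 0), ?_⟩
    rw [add_sub_cancel_right, ← key]
    congr 1
    ext i j
    by_cases hi : i = Fin.castLE h 0
    · simp [hi, vecMulVec_apply]
    · rw [hY i j (by rwa [Ne, h0])]
      simp [vecMulVec_apply, hi]

theorem isTypeTwo_setOf_inRow {m n : ℕ} (B : Matrix (Fin m) (Fin n) D) {q : Fin n → D}
    (hq : q ≠ 0) : IsTypeTwo {X | InRow q (X - B)} := by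
  obtain ⟨h, Q, hQ, hQq⟩ := exists_isUnit_rows (v := fun _ : Fin 1 => q)
    (LinearIndependent.of_subsingleton 0 hq)
  have h0 : ∀ i : Fin n, i.val = 0 ↔ i = Fin.castLE h 0 := fun i => by simp [Fin.ext_iff]
  have key : ∀ (u : Fin m → D), vecMulVec u (Pi.single (Fin.castLE h 0) 1) * Q = vecMulVec u q := by
    intro u
    rw [vecMulVec_mul]
    congr 1
    ext i
    simp [hQq]
  refine ⟨Q, B, hQ, Set.ext fun X => ⟨?_, ?_⟩⟩
  · rintro ⟨u, hu⟩
    refine ⟨vecMulVec u (Pi.single (Fin.castLE h 0) 1), fun i j hj => ?_, ?_⟩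
    · rw [Ne, h0] at hj
      simp [vecMulVec_apply, hj]
    · simp only [key, ← hu, sub_add_cancel]
  · rintro ⟨Y, hY, rfl⟩
    refine ⟨fun i => Y i (Fin.castLE h 0), ?_⟩
    rw [add_sub_cancel_right, ← key]
    congr 1
    ext i j
    by_cases hj : j = Fin.castLE h 0
    · simp [hj, vecMulVec_apply]
    · rw [hY i j (by rwa [Ne, h0])]
      simp [vecMulVec_apply, hj]

theorem isDyadHom_of_not_degenerate {m n m' n' : ℕ}
    {φ : Matrix (Fin m) (Fin n) D → Matrix (Fin m') (Fin n') D}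
    (hhom : ∀ X Y, mrank (X - Y) = 1 → mrank (φ X - φ Y) = 1) (hnd : ¬ Degenerate φ)
    (h0 : φ 0 = 0) : IsDyadHom φ where
  map_zero := h0
  ne X Y hXY hd :=
    sub_ne_zero.1 ((mrank_eq_one_iff _).1
      (hhom X Y ((mrank_eq_one_iff _).2 ⟨sub_ne_zero.2 hXY, hd⟩))).1
  isDyad X Y hd := by
    by_cases hXY : X = Y
    · rw [hXY, sub_self]
      exact isDyad_zero
    · exact ((mrank_eq_one_iff _).1
        (hhom X Y ((mrank_eq_one_iff _).2 ⟨sub_ne_zero.2 hXY, hd⟩))).2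
  nondeg A hA p q hp hq := by
    by_contra! hX
    refine hnd ⟨A, (mrank_le_one_iff_isDyad A).2 hA, _, _, isTypeOne_setOf_inColumn (φ A) hp,
      isTypeTwo_setOf_inRow (φ A) hq, ⟨?_, ?_⟩, ?_⟩
    · simpa using inColumn_zero p
    · simpa using inRow_zero q
    · rintro _ ⟨X, hXA, rfl⟩
      exact or_iff_not_imp_left.2 (hX X ((mrank_le_one_iff_isDyad _).1 hXA))

theorem exists_two_ne_zero_ne_one {R : Type*} [DivisionRing R]
    (hR : (4 : Cardinal) ≤ Cardinal.mk R) :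
    ∃ g h : R, g ≠ 0 ∧ g ≠ 1 ∧ h ≠ 0 ∧ h ≠ 1 ∧ g ≠ h := by
  classical
  have key : ∀ s : Finset R, s.card ≤ 3 → ∃ g, g ∉ s := by
    intro s hs
    by_contra! h
    have hmk : Cardinal.mk R ≤ 3 := by
      have : Cardinal.mk R ≤ Cardinal.mk s :=
        Cardinal.mk_le_of_injective (f := fun g => (⟨g, h g⟩ : s)) fun a b hab => by simpa using hab
      rw [Cardinal.mk_coe_finset] at this
      exact this.trans (by exact_mod_cast hs)
    have : (4 : Cardinal) ≤ 3 := hR.trans hmk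
    norm_num at this
  obtain ⟨g, hg⟩ := key {0, 1} (Finset.card_le_two.trans (by norm_num))
  obtain ⟨h, hh⟩ := key {0, 1, g} Finset.card_le_three
  simp only [Finset.mem_insert, Finset.mem_singleton, not_or] at hg hh
  exact ⟨g, h, hg.1, hg.2, hh.1, hh.2.1, Ne.symm hh.2.2⟩

theorem surjective_of_ringHom_op (hEAS : ∀ f : D →+* D, Function.Surjective f)
    (ρ : D →+* Dᵐᵒᵖ) : Function.Surjective ρ := by
  intro e
  obtain ⟨d, hd⟩ := hEAS (((RingEquiv.opOp D).symm.toRingHom.comp (RingHom.op ρ)).comp ρ) (unop e)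
  exact ⟨unop (ρ d), unop_injective hd⟩

theorem unopTranspose_embedM {a b a' b' : ℕ} (Y : Matrix (Fin a) (Fin b) Dᵐᵒᵖ) :
    unopTranspose (embedM Y : Matrix (Fin a') (Fin b') Dᵐᵒᵖ) = embedM (unopTranspose Y) := by
  ext i j
  simp only [unopTranspose, embedM, map_apply, transpose_apply, of_apply, and_comm (b := j.val < a)]
  split_ifs <;> rfl

end Rank

/-- Corollary 2.2: over an EAS division ring `D` with `|D| ≥ 4`, every non-degenerate graph
homomorphism `φ : D^{m×n} → D^{m'×n'}` with `φ(0) = 0` is of one of the two standard forms,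
with `τ` a ring automorphism or `σ` a ring anti-automorphism of `D`. -/
theorem corollary_EAS_division_ring
    {D : Type} [DivisionRing D]
    (hEAS : ∀ f : D →+* D, Function.Surjective f)
    (hD : (4 : Cardinal) ≤ Cardinal.mk D)
    {m n m' n' : ℕ} (hm : 2 ≤ m) (hn : 2 ≤ n) (hm' : 2 ≤ m') (hn' : 2 ≤ n')
    (φ : Matrix (Fin m) (Fin n) D → Matrix (Fin m') (Fin n') D)
    (hhom : ∀ X Y, mrank (X - Y) = 1 → mrank (φ X - φ Y) = 1)
    (hnd : ¬ Degenerate φ) (h0 : φ 0 = 0) :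
    (m ≤ m' ∧ n ≤ n' ∧
      ∃ P : Matrix (Fin m') (Fin m') D, ∃ Q : Matrix (Fin n') (Fin n') D,
        IsUnit P ∧ IsUnit Q ∧
        ∃ τ : D ≃+* D,
          ∀ X : Matrix (Fin m) (Fin n) D,
            φ X = P * (embedM (X.map τ) : Matrix (Fin m') (Fin n') D) * Q) ∨
    (n ≤ m' ∧ m ≤ n' ∧
      ∃ P : Matrix (Fin m') (Fin m') D, ∃ Q : Matrix (Fin n') (Fin n') D,
        IsUnit P ∧ IsUnit Q ∧
        ∃ σ : D → D,
          Function.Bijective σ ∧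
          (∀ a b, σ (a + b) = σ a + σ b) ∧ (∀ a b, σ (a * b) = σ b * σ a) ∧ σ 1 = 1 ∧
          ∀ X : Matrix (Fin m) (Fin n) D,
            φ X = P * (embedM ((X.map σ)ᵀ) : Matrix (Fin m') (Fin n') D) * Q) := by
  have : NeZero m := ⟨by omega⟩
  have : NeZero n := ⟨by omega⟩
  have : NeZero m' := ⟨by omega⟩
  have : NeZero n' := ⟨by omega⟩
  have h := isDyadHom_of_not_degenerate hhom hnd h0
  have hD' := exists_two_ne_zero_ne_one hD
  rcases h.isDyadMap_zero.isStandard_or_swap with hs | hs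
  · left
    obtain ⟨hm, hn, P, Q, hP, hQ, σ, hσ⟩ := h.exists_eq_mul_embedM_mul hs hEAS hD'
    exact ⟨hm, hn, P, Q, hP, hQ, RingEquiv.ofBijective σ ⟨σ.injective, hEAS σ⟩, hσ⟩
  · right
    have hs' : IsStandard fun x y => opTranspose (φ (vecMulVec x y)) := by
      constructor
      · intro x hx
        obtain ⟨q, hq, hr⟩ := hs.row x hx
        exact ⟨MulOpposite.op ∘ q, op_comp_ne_zero hq, fun y => inColumn_opTranspose.2 (hr y)⟩
      · intro y hy
        obtain ⟨p, hp, hc⟩ := hs.column y hy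
        exact ⟨MulOpposite.op ∘ p, op_comp_ne_zero hp, fun x => inRow_opTranspose.2 (hc x)⟩
    have hsurj := surjective_of_ringHom_op hEAS
    obtain ⟨hm, hn, P, Q, hP, hQ, σ, hσ⟩ :=
      h.opTranspose_comp.exists_eq_mul_embedM_mul hs' hsurj hD'
    refine ⟨hn, hm, unopTranspose Q, unopTranspose P, isUnit_unopTranspose hQ,
      isUnit_unopTranspose hP, MulOpposite.unop ∘ σ,
      MulOpposite.unop_bijective.comp ⟨σ.injective, hsurj σ⟩, fun a b => by simp,
      fun a b => by simp, by simp, fun X => ?_⟩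
    have hX := congrArg unopTranspose (hσ X)
    rw [unopTranspose_mul, unopTranspose_mul, unopTranspose_embedM, ← Matrix.mul_assoc] at hX
    exact hX
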